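/- arXiv:1001.2413 — 2 statements merged into one kernel-verified Lean document; each statement's English description precedes it below -/
import Mathlib

section
/- For the fractional-linear BPRE with Z_0 = 1, for every s ∈ [0,1) and every n ≥ 1, E[s^{Z_n}; T = n+1] = E[Δ_n(s)], where Δ_n(s) := f_{0,n}(s f(0)) − f_{0,n}(0) admits the explicit representation Δ_n(s) = (a_n + b_n)^{−1} (a_n/(1 − s f(0)) + b_n)^{−1} X_f(s) e^{−S_n}, with X_f(s) := s f(0)/(1 − s f(0)), a_n = e^{−S_n}, b_n = Σ_{i=0}^{n−1} η_{i+1} e^{−S_i}, and f distributed as f_{n+1} and independent of f_1, …, f_n. -/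
open MeasureTheory ProbabilityTheory Filter Set Topology

noncomputable section

namespace BPREpaper

variable {Ω : Type*} [MeasurableSpace Ω]

/-- The random walk `S n = X 1 + ... + X n` (increments indexed from `1`, `S 0 = 0`). -/
def walk (X : ℕ → Ω → ℝ) (n : ℕ) (ω : Ω) : ℝ := ∑ i ∈ Finset.Icc 1 n, X i ω

/-- `Mwalk X n = max (S 1, ..., S n)` for `n ≥ 1` (junk value `0` for `n = 0`). -/
def Mwalk (X : ℕ → Ω → ℝ) : ℕ → Ω → ℝ
  | 0, _ => 0
  | n + 1, ω =>
      (Finset.Icc 1 (n + 1)).sup' (Finset.nonempty_Icc.mpr (by omega)) fun i => walk X i ω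

/-- `Lwalk X n = min (S 1, ..., S n)` for `n ≥ 1` (junk value `0` for `n = 0`). -/
def Lwalk (X : ℕ → Ω → ℝ) : ℕ → Ω → ℝ
  | 0, _ => 0
  | n + 1, ω =>
      (Finset.Icc 1 (n + 1)).inf' (Finset.nonempty_Icc.mpr (by omega)) fun i => walk X i ω

/-- minimum of `S 0, S 1, ..., S n`. -/
def minWalk (X : ℕ → Ω → ℝ) (n : ℕ) (ω : Ω) : ℝ :=
  (Finset.range (n + 1)).inf' (by simp) fun i => walk X i ω

/-- `τ(n)`: the first moment at which the minimum of `S 0, ..., S n` is attained. -/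
def tauWalk (X : ℕ → Ω → ℝ) (n : ℕ) (ω : Ω) : ℕ :=
  sInf {i : ℕ | walk X i ω = minWalk X n ω}

/-- The renewal function `u(x) = 1 + ∑_{k ≥ 1} P(-S_k ≤ x, M_k < 0)` for `x ≥ 0`,
`u(x) = 0` for `x < 0`. -/
def uFun (μ : Measure Ω) (X : ℕ → Ω → ℝ) (x : ℝ) : ℝ :=
  if 0 ≤ x then
    1 + ∑' k : ℕ, (μ {ω | -walk X (k + 1) ω ≤ x ∧ Mwalk X (k + 1) ω < 0}).toReal
  else 0

/-- The renewal function `v(x) = 1 + ∑_{k ≥ 1} P(-S_k > x, L_k ≥ 0)` for `x ≤ 0`,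
`v(x) = 0` for `x > 0`. -/
def vFun (μ : Measure Ω) (X : ℕ → Ω → ℝ) (x : ℝ) : ℝ :=
  if x ≤ 0 then
    1 + ∑' k : ℕ, (μ {ω | x < -walk X (k + 1) ω ∧ 0 ≤ Lwalk X (k + 1) ω}).toReal
  else 0

/-- The event `{∀ 1 ≤ i ≤ n, x + S_i ≥ 0} = {L_n ≥ 0}` for the walk started at `x`. -/
def posSet (X : ℕ → Ω → ℝ) (x : ℝ) (n : ℕ) : Set Ω :=
  {ω | ∀ i ∈ Finset.Icc 1 n, 0 ≤ x + walk X i ω}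

/-- The event `{∀ 1 ≤ i ≤ n, x + S_i < 0} = {M_n < 0}` for the walk started at `x`. -/
def negSet (X : ℕ → Ω → ℝ) (x : ℝ) (n : ℕ) : Set Ω :=
  {ω | ∀ i ∈ Finset.Icc 1 n, x + walk X i ω < 0}

/-- A distribution on `ℝ` is non-lattice: it is not concentrated on any arithmetic
progression `a + hℤ`. -/
def NonLattice (ν : Measure ℝ) : Prop :=
  ¬ ∃ a h : ℝ, ν {x | ∃ k : ℤ, x = a + k * h} = 1

/-- `ν` is an `α`-stable law on `ℝ`. -/
def IsStableLaw (α : ℝ) (ν : Measure ℝ) : Prop :=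
  ∀ a b : ℝ, 0 < a → 0 < b → ∃ c d : ℝ, 0 < c ∧ a ^ α + b ^ α = c ^ α ∧
    ((ν.map (fun x => a * x)).prod (ν.map (fun x => b * x))).map (fun p : ℝ × ℝ => p.1 + p.2)
      = ν.map (fun x => c * x + d)

/-- Weak convergence of a sequence of laws on `ℝ`, tested against bounded continuous
functions. -/
def WeakTendsto (μs : ℕ → Measure ℝ) (ν : Measure ℝ) : Prop :=
  ∀ g : BoundedContinuousFunction ℝ ℝ,
    Tendsto (fun n => ∫ x, g x ∂(μs n)) atTop (𝓝 (∫ x, g x ∂ν))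

/-- Assumption A4: there are norming constants `c n → ∞` such that `S n / c n` converges in
distribution to an `α`-stable law concentrated neither on `[0,∞)` nor on `(-∞,0]`; the
increment distribution is non-lattice. -/
def AssumptionA4 (μ : Measure Ω) (X : ℕ → Ω → ℝ) (c : ℕ → ℝ) : Prop :=
  Tendsto c atTop atTop ∧ NonLattice (μ.map (X 1)) ∧
    ∃ (α : ℝ) (ν : Measure ℝ), IsProbabilityMeasure ν ∧ IsStableLaw α ν ∧
      0 < ν (Set.Iio 0) ∧ 0 < ν (Set.Ioi 0) ∧
      WeakTendsto (fun n => μ.map fun ω => walk X n ω / c n) ν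

/-- A family of random elements indexed by `ι` which is i.i.d. (the common distribution
being that of the element with index `i0`). -/
def IIDfam {ι : Type*} {E : Type*} [MeasurableSpace E] (μ : Measure Ω) (Q : ι → Ω → E)
    (i0 : ι) : Prop :=
  (∀ i, Measurable (Q i)) ∧ iIndepFun Q μ ∧
    ∀ i, IdentDistrib (Q i) (Q i0) μ μ

/-- An i.i.d. sequence indexed by `ℕ` (indices from `1` are the relevant ones). -/
def IIDseq {E : Type*} [MeasurableSpace E] (μ : Measure Ω) (Q : ℕ → Ω → E) : Prop :=
  IIDfam μ Q 1

/-- `P` is the h-transform measure `P_x⁺`: for every `n` and every bounded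
`F n`-measurable `g`, `E_P[g] = u(x)⁻¹ E_x[g · u(S_n); L_n ≥ 0]`. -/
def IsPplus (μ : Measure Ω) (X : ℕ → Ω → ℝ) (F : ℕ → MeasurableSpace Ω) (x : ℝ)
    (P : Measure Ω) : Prop :=
  IsProbabilityMeasure P ∧
    ∀ (n : ℕ) (g : Ω → ℝ), Measurable[F n] g → (∃ C, ∀ ω, |g ω| ≤ C) →
      ∫ ω, g ω ∂P =
        (uFun μ X x)⁻¹ * ∫ ω in posSet X x n, g ω * uFun μ X (x + walk X n ω) ∂μ

/-- `P` is the h-transform measure `P_x⁻`: for every `n` and every bounded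
`F n`-measurable `g`, `E_P[g] = v(x)⁻¹ E_x[g · v(S_n); M_n < 0]`. -/
def IsPminus (μ : Measure Ω) (X : ℕ → Ω → ℝ) (F : ℕ → MeasurableSpace Ω) (x : ℝ)
    (P : Measure Ω) : Prop :=
  IsProbabilityMeasure P ∧
    ∀ (n : ℕ) (g : Ω → ℝ), Measurable[F n] g → (∃ C, ∀ ω, |g ω| ≤ C) →
      ∫ ω, g ω ∂P =
        (vFun μ X x)⁻¹ * ∫ ω in negSet X x n, g ω * vFun μ X (x + walk X n ω) ∂μ

/-- The filtration generated by the environment `Q 1, ..., Q n`. -/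
def envFiltration {E : Type*} [MeasurableSpace E] (Q : ℕ → Ω → E) (n : ℕ) :
    MeasurableSpace Ω :=
  ⨆ i ∈ Finset.Icc 1 n, MeasurableSpace.comap (Q i) inferInstance

/-- The σ-algebra generated by the whole environment `Q 1, Q 2, ...`. -/
def envSigma {E : Type*} [MeasurableSpace E] (Q : ℕ → Ω → E) : MeasurableSpace Ω :=
  ⨆ i, MeasurableSpace.comap (Q (i + 1)) inferInstance




/-- Probability generating function of the (random) offspring law `Q n`. -/
def pgf (Q : ℕ → Ω → Measure ℕ) (n : ℕ) (ω : Ω) (s : ℝ) : ℝ :=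
  ∑' i : ℕ, (Q n ω {i}).toReal * s ^ i

/-- Mean `m(Q_n)` of the offspring law `Q n`. -/
def meanQ (Q : ℕ → Ω → Measure ℕ) (n : ℕ) (ω : Ω) : ℝ :=
  ∑' i : ℕ, (i : ℝ) * (Q n ω {i}).toReal

/-- `X_n = log f_n'(1)`, the increments of the associated random walk. -/
def Xenv (Q : ℕ → Ω → Measure ℕ) (n : ℕ) (ω : Ω) : ℝ := Real.log (meanQ Q n ω)

/-- `η_n = f_n''(1) / (2 f_n'(1)^2)`. -/
def etaEnv (Q : ℕ → Ω → Measure ℕ) (n : ℕ) (ω : Ω) : ℝ :=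
  (∑' i : ℕ, ((i : ℝ) * ((i : ℝ) - 1)) * (Q n ω {i}).toReal) / (2 * meanQ Q n ω ^ 2)

/-- The associated random walk `S_n = X_1 + ... + X_n`. -/
def Senv (Q : ℕ → Ω → Measure ℕ) : ℕ → Ω → ℝ := walk (Xenv Q)

/-- The composition `f_{j,n}(s) = f_{j+1}(f_{j+2}(⋯ f_n(s) ⋯))`, with `f_{j,n} = id` for
`n ≤ j`. -/
def pgfComp (Q : ℕ → Ω → Measure ℕ) (j : ℕ) : ℕ → Ω → ℝ → ℝ
  | 0, _, s => s
  | n + 1, ω, s => if n + 1 ≤ j then s else pgfComp Q j n ω (pgf Q (n + 1) ω s)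

/-- `b_n = ∑_{i=0}^{n-1} η_{i+1} e^{-S_i}`. -/
def bEnv (Q : ℕ → Ω → Measure ℕ) (n : ℕ) (ω : Ω) : ℝ :=
  ∑ i ∈ Finset.range n, etaEnv Q (i + 1) ω * Real.exp (-(Senv Q i ω))

/-- `B⁺ = ∑_{i=0}^∞ η_{i+1} e^{-S_i}`. -/
def Bplus (Q : ℕ → Ω → Measure ℕ) (ω : Ω) : ℝ :=
  ∑' i : ℕ, etaEnv Q (i + 1) ω * Real.exp (-(Senv Q i ω))

/-- `B⁻ = ∑_{i=1}^∞ η_i e^{S_i}`. -/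
def Bminus (Q : ℕ → Ω → Measure ℕ) (ω : Ω) : ℝ :=
  ∑' i : ℕ, etaEnv Q (i + 1) ω * Real.exp (Senv Q (i + 1) ω)

/-- `V_∞(r) = 1 / (B⁻ + (1 - r)⁻¹)`. -/
def Vinf (Q : ℕ → Ω → Measure ℕ) (r : ℝ) (ω : Ω) : ℝ := (Bminus Q ω + (1 - r)⁻¹)⁻¹

/-- All the offspring generating functions are fractional linear:
`1/(1 - f_n(s)) = e^{-X_n}/(1-s) + η_n`. -/
def FracLinear (Q : ℕ → Ω → Measure ℕ) : Prop :=
  ∀ n, 1 ≤ n → ∀ ω : Ω, ∀ s : ℝ, 0 ≤ s → s < 1 →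
    (1 - pgf Q n ω s)⁻¹ = Real.exp (-(Xenv Q n ω)) / (1 - s) + etaEnv Q n ω

/-- Assumption A1 with explicit constant `χ`. -/
def AssumptionA1With (μ : Measure Ω) (Q : ℕ → Ω → Measure ℕ) (χ : ℝ) : Prop :=
  0 < χ ∧ χ < 1 / 2 ∧ ∀ n, 1 ≤ n →
    ∀ᵐ ω ∂μ, χ ≤ pgf Q n ω 0 ∧ pgf Q n ω 0 ≤ 1 - χ ∧ χ ≤ etaEnv Q n ω

/-- Assumption A1: for some `χ ∈ (0,1/2)`, `χ ≤ f(0) ≤ 1 - χ` and `η ≥ χ` a.s. -/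
def AssumptionA1 (μ : Measure Ω) (Q : ℕ → Ω → Measure ℕ) : Prop :=
  ∃ χ : ℝ, AssumptionA1With μ Q χ

/-- Assumption A2: `X` has zero mean, finite positive variance and is non-lattice. -/
def AssumptionA2 (μ : Measure Ω) (Q : ℕ → Ω → Measure ℕ) : Prop :=
  Integrable (Xenv Q 1) μ ∧ (∫ ω, Xenv Q 1 ω ∂μ) = 0 ∧
    Integrable (fun ω => Xenv Q 1 ω ^ 2) μ ∧ 0 < ∫ ω, Xenv Q 1 ω ^ 2 ∂μ ∧
    NonLattice (μ.map (Xenv Q 1))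

/-- `ζ(a) = ∑_{y ≥ a} y² Q({y}) / m(Q)²`. -/
def zetaEnv (Q : ℕ → Ω → Measure ℕ) (a : ℕ) (ω : Ω) : ℝ :=
  (∑' y : ℕ, if a ≤ y then (y : ℝ) ^ 2 * (Q 1 ω {y}).toReal else 0) / meanQ Q 1 ω ^ 2

/-- Assumption A3: `E[(log⁺ ζ(a))^{2+ε}] < ∞` for some `ε > 0`, `a ∈ ℕ`. -/
def AssumptionA3 (μ : Measure Ω) (Q : ℕ → Ω → Measure ℕ) : Prop :=
  ∃ ε : ℝ, 0 < ε ∧ ∃ a : ℕ, 1 ≤ a ∧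
    Integrable (fun ω => Real.log (max (zetaEnv Q a ω) 1) ^ (2 + ε)) μ

/-- The extinction moment `T = min {k ≥ 0 : Z_k = 0}`. -/
def extinctTime (Z : ℕ → Ω → ℕ) (ω : Ω) : ℕ := sInf {k | Z k ω = 0}

/-- The branching property of `Z` in the environment `Q` (started from one particle):
given the environment and `Z_k`, the conditional generating function of `Z_n` is
`f_{k,n}(s)^{Z_k}`; the state `0` is absorbing. -/
def BranchingProperty (μ : Measure Ω) (Q : ℕ → Ω → Measure ℕ) (Z : ℕ → Ω → ℕ) : Prop :=
  (∀ ω, Z 0 ω = 1) ∧ (∀ n, Measurable (Z n)) ∧ (∀ n ω, Z n ω = 0 → Z (n + 1) ω = 0) ∧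
    ∀ k n : ℕ, k ≤ n → ∀ s : ℝ, 0 ≤ s → s ≤ 1 →
      (μ[fun ω => s ^ Z n ω | envSigma Q ⊔ MeasurableSpace.comap (Z k) inferInstance])
        =ᵐ[μ] fun ω => pgfComp Q k n ω s ^ Z k ω



/-- The largest multiple of `1 / (N + 1)` below `x`, for `x ≥ 0`. -/
def gridFloor (N : ℕ) (x : ℝ) : ℝ := (⌊x * ((N + 1 : ℕ) : ℝ)⌋₊ : ℝ) / ((N + 1 : ℕ) : ℝ)

lemma gridFloor_mem_Ico (N : ℕ) {x : ℝ} (hx : x ∈ Ico (0 : ℝ) 1) :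
    gridFloor N x ∈ Ico (0 : ℝ) 1 := by
  have hN : (0 : ℝ) < ((N + 1 : ℕ) : ℝ) := by positivity
  refine ⟨by unfold gridFloor; positivity, lt_of_le_of_lt ?_ hx.2⟩
  unfold gridFloor
  rw [div_le_iff₀ hN]
  exact Nat.floor_le (mul_nonneg hx.1 hN.le)

lemma tendsto_gridFloor {x : ℝ} (hx : 0 ≤ x) :
    Tendsto (fun N => gridFloor N x) atTop (𝓝 x) :=
  (tendsto_nat_floor_mul_div_atTop hx).comp
    (tendsto_natCast_atTop_atTop.comp (tendsto_add_atTop_nat 1))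

section RandomParameter

variable {α : Type*} {m m0 : MeasurableSpace α} {μ : Measure α} {F G : ℝ → α → ℝ} {r : α → ℝ}

lemma comp_gridFloor_eq_sum (F : ℝ → α → ℝ) (hr : ∀ ω, r ω ∈ Ico (0 : ℝ) 1) (N : ℕ) (ω : α) :
    F (gridFloor N (r ω)) ω = ∑ j ∈ Finset.range (N + 1),
      {ω | ⌊r ω * ((N + 1 : ℕ) : ℝ)⌋₊ = j}.indicator (F ((j : ℝ) / ((N + 1 : ℕ) : ℝ))) ω := by
  have hN : (0 : ℝ) < ((N + 1 : ℕ) : ℝ) := by positivity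
  have hlt : ⌊r ω * ((N + 1 : ℕ) : ℝ)⌋₊ < N + 1 := by
    rw [Nat.floor_lt (mul_nonneg (hr ω).1 hN.le)]
    nlinarith [(hr ω).2]
  rw [Finset.sum_eq_single_of_mem _ (Finset.mem_range.mpr hlt)]
  · simp [gridFloor]
  · intro j _ hj
    exact indicator_of_notMem (fun h => hj h.symm) _

lemma natCast_div_mem_Ico {N j : ℕ} (hj : j ∈ Finset.range (N + 1)) :
    (j : ℝ) / ((N + 1 : ℕ) : ℝ) ∈ Ico (0 : ℝ) 1 := by
  have hN : (0 : ℝ) < ((N + 1 : ℕ) : ℝ) := by positivity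
  refine ⟨by positivity, ?_⟩
  rw [div_lt_one hN]
  exact_mod_cast Finset.mem_range.mp hj

lemma measurableSet_floor_eq (hr : Measurable[m] r) (N j : ℕ) :
    MeasurableSet[m] {ω | ⌊r ω * ((N + 1 : ℕ) : ℝ)⌋₊ = j} :=
  (Nat.measurable_floor.comp (hr.mul_const _)) (measurableSet_singleton j)

lemma aestronglyMeasurable_comp_gridFloor
    (hF : ∀ v ∈ Ico (0 : ℝ) 1, AEStronglyMeasurable (F v) μ)
    (hr : Measurable r) (hr01 : ∀ ω, r ω ∈ Ico (0 : ℝ) 1) (N : ℕ) :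
    AEStronglyMeasurable (fun ω => F (gridFloor N (r ω)) ω) μ := by
  simp_rw [comp_gridFloor_eq_sum F hr01 N]
  exact Finset.aestronglyMeasurable_fun_sum _ fun j hj =>
    (hF _ (natCast_div_mem_Ico hj)).indicator (measurableSet_floor_eq hr N j)

/-- A random function on `[0, 1)` with continuous paths can be evaluated measurably at a random
argument. -/
lemma aestronglyMeasurable_comp_random
    (hF : ∀ v ∈ Ico (0 : ℝ) 1, AEStronglyMeasurable (F v) μ)
    (hFc : ∀ ω, ContinuousOn (fun v => F v ω) (Ico 0 1))
    (hr : Measurable r) (hr01 : ∀ ω, r ω ∈ Ico (0 : ℝ) 1) :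
    AEStronglyMeasurable (fun ω => F (r ω) ω) μ := by
  refine aestronglyMeasurable_of_tendsto_ae atTop
    (fun N => aestronglyMeasurable_comp_gridFloor hF hr hr01 N) (ae_of_all _ fun ω => ?_)
  exact (hFc ω _ (hr01 ω)).tendsto.comp (tendsto_nhdsWithin_iff.mpr
    ⟨tendsto_gridFloor (hr01 ω).1, Eventually.of_forall fun N => gridFloor_mem_Ico N (hr01 ω)⟩)

lemma tendsto_integral_comp_gridFloor [IsFiniteMeasure μ]
    (hF : ∀ v ∈ Ico (0 : ℝ) 1, AEStronglyMeasurable (F v) μ)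
    (hFb : ∀ v ∈ Ico (0 : ℝ) 1, ∀ ω, ‖F v ω‖ ≤ 1)
    (hFc : ∀ ω, ContinuousOn (fun v => F v ω) (Ico 0 1))
    (hr : Measurable r) (hr01 : ∀ ω, r ω ∈ Ico (0 : ℝ) 1) :
    Tendsto (fun N => ∫ ω, F (gridFloor N (r ω)) ω ∂μ) atTop (𝓝 (∫ ω, F (r ω) ω ∂μ)) := by
  refine tendsto_integral_of_dominated_convergence (fun _ => 1)
    (fun N => aestronglyMeasurable_comp_gridFloor hF hr hr01 N) (integrable_const _)
    (fun N => ae_of_all _ fun ω => hFb _ (gridFloor_mem_Ico N (hr01 ω)) ω)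
    (ae_of_all _ fun ω => ?_)
  exact (hFc ω _ (hr01 ω)).tendsto.comp (tendsto_nhdsWithin_iff.mpr
    ⟨tendsto_gridFloor (hr01 ω).1, Eventually.of_forall fun N => gridFloor_mem_Ico N (hr01 ω)⟩)

lemma integral_comp_gridFloor [IsFiniteMeasure μ]
    (hF : ∀ v ∈ Ico (0 : ℝ) 1, AEStronglyMeasurable (F v) μ)
    (hFb : ∀ v ∈ Ico (0 : ℝ) 1, ∀ ω, ‖F v ω‖ ≤ 1)
    (hr : Measurable r) (hr01 : ∀ ω, r ω ∈ Ico (0 : ℝ) 1) (N : ℕ) :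
    ∫ ω, F (gridFloor N (r ω)) ω ∂μ = ∑ j ∈ Finset.range (N + 1),
      ∫ ω in {ω | ⌊r ω * ((N + 1 : ℕ) : ℝ)⌋₊ = j}, F ((j : ℝ) / ((N + 1 : ℕ) : ℝ)) ω ∂μ := by
  simp_rw [comp_gridFloor_eq_sum F hr01 N]
  rw [integral_finsetSum]
  · exact Finset.sum_congr rfl fun j _ => integral_indicator (measurableSet_floor_eq hr N j)
  · intro j hj
    have hj' := natCast_div_mem_Ico hj
    exact (Integrable.of_bound (hF _ hj') 1 (ae_of_all _ (hFb _ hj'))).indicator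
      (measurableSet_floor_eq hr N j)

/-- If `G v` is the conditional expectation of `F v` for every fixed `v`, then the expectations
of `F` and `G` agree also at a random argument which is measurable for the conditioning. -/
lemma integral_comp_random_eq [IsFiniteMeasure μ] (hm : m ≤ m0)
    (hF : ∀ v ∈ Ico (0 : ℝ) 1, AEStronglyMeasurable (F v) μ)
    (hFb : ∀ v ∈ Ico (0 : ℝ) 1, ∀ ω, ‖F v ω‖ ≤ 1)
    (hFc : ∀ ω, ContinuousOn (fun v => F v ω) (Ico 0 1))
    (hG : ∀ v ∈ Ico (0 : ℝ) 1, AEStronglyMeasurable (G v) μ)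
    (hGb : ∀ v ∈ Ico (0 : ℝ) 1, ∀ ω, ‖G v ω‖ ≤ 1)
    (hGc : ∀ ω, ContinuousOn (fun v => G v ω) (Ico 0 1))
    (hFG : ∀ v ∈ Ico (0 : ℝ) 1, μ[F v | m] =ᵐ[μ] G v)
    (hr : Measurable[m] r) (hr01 : ∀ ω, r ω ∈ Ico (0 : ℝ) 1) :
    ∫ ω, F (r ω) ω ∂μ = ∫ ω, G (r ω) ω ∂μ := by
  have hr0 : Measurable r := hr.mono hm le_rfl
  refine tendsto_nhds_unique (tendsto_integral_comp_gridFloor hF hFb hFc hr0 hr01) ?_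
  refine (tendsto_integral_comp_gridFloor hG hGb hGc hr0 hr01).congr fun N => ?_
  rw [integral_comp_gridFloor hF hFb hr0 hr01, integral_comp_gridFloor hG hGb hr0 hr01]
  refine Finset.sum_congr rfl fun j hj => ?_
  have hj' := natCast_div_mem_Ico hj
  rw [← setIntegral_condExp hm (Integrable.of_bound (hF _ hj') 1 (ae_of_all _ (hFb _ hj')))
    (measurableSet_floor_eq hr N j)]
  exact integral_congr_ae (ae_restrict_of_ae (hFG _ hj').symm)

end RandomParameter

section FractionalLinear

variable {α : Type*} {Q : ℕ → α → Measure ℕ}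

lemma pgf_nonneg (Q : ℕ → α → Measure ℕ) (n : ℕ) (ω : α) {s : ℝ} (hs : 0 ≤ s) :
    0 ≤ pgf Q n ω s :=
  tsum_nonneg fun _ => by positivity

lemma pgf_zero (Q : ℕ → α → Measure ℕ) (n : ℕ) (ω : α) :
    pgf Q n ω 0 = (Q n ω {0}).toReal := by
  unfold pgf
  rw [tsum_eq_single 0 (fun i hi => by simp [hi])]
  simp

lemma etaEnv_nonneg (Q : ℕ → α → Measure ℕ) (n : ℕ) (ω : α) : 0 ≤ etaEnv Q n ω := by
  refine div_nonneg (tsum_nonneg fun i => mul_nonneg ?_ ENNReal.toReal_nonneg) (by positivity)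
  rcases Nat.eq_zero_or_pos i with rfl | hi
  · simp
  · have : (1 : ℝ) ≤ i := by exact_mod_cast hi
    exact mul_nonneg (by positivity) (by linarith)

lemma bEnv_nonneg (Q : ℕ → α → Measure ℕ) (n : ℕ) (ω : α) : 0 ≤ bEnv Q n ω :=
  Finset.sum_nonneg fun _ _ => mul_nonneg (etaEnv_nonneg Q _ ω) (Real.exp_pos _).le

lemma FracLinear.pgf_mem_Ico (hfrac : FracLinear Q) {n : ℕ} (hn : 1 ≤ n) (ω : α) {s : ℝ}
    (hs : s ∈ Ico (0 : ℝ) 1) : pgf Q n ω s ∈ Ico (0 : ℝ) 1 := by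
  refine ⟨pgf_nonneg Q n ω hs.1, ?_⟩
  have hpos : 0 < (1 - pgf Q n ω s)⁻¹ := by
    rw [hfrac n hn ω s hs.1 hs.2]
    exact add_pos_of_pos_of_nonneg (div_pos (Real.exp_pos _) (sub_pos.mpr hs.2))
      (etaEnv_nonneg Q n ω)
  linarith [inv_pos.mp hpos]

lemma pgfComp_zero_succ (Q : ℕ → α → Measure ℕ) (n : ℕ) (ω : α) (s : ℝ) :
    pgfComp Q 0 (n + 1) ω s = pgfComp Q 0 n ω (pgf Q (n + 1) ω s) := by
  simp [pgfComp]

lemma pgfComp_self (Q : ℕ → α → Measure ℕ) (n : ℕ) (ω : α) (s : ℝ) :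
    pgfComp Q n n ω s = s := by
  cases n <;> simp [pgfComp]

lemma pgfComp_self_succ (Q : ℕ → α → Measure ℕ) (n : ℕ) (ω : α) (s : ℝ) :
    pgfComp Q n (n + 1) ω s = pgf Q (n + 1) ω s := by
  simp [pgfComp, pgfComp_self]

lemma FracLinear.pgfComp_mem_Ico (hfrac : FracLinear Q) (n : ℕ) (ω : α) {s : ℝ}
    (hs : s ∈ Ico (0 : ℝ) 1) : pgfComp Q 0 n ω s ∈ Ico (0 : ℝ) 1 := by
  induction n generalizing s with
  | zero => exact hs
  | succ n ih =>
    rw [pgfComp_zero_succ]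
    exact ih (hfrac.pgf_mem_Ico (by omega) ω hs)

/-- Fractional-linear generating functions are closed under composition. -/
lemma FracLinear.inv_one_sub_pgfComp (hfrac : FracLinear Q) (n : ℕ) (ω : α) {s : ℝ}
    (hs : s ∈ Ico (0 : ℝ) 1) :
    (1 - pgfComp Q 0 n ω s)⁻¹ = Real.exp (-(Senv Q n ω)) / (1 - s) + bEnv Q n ω := by
  induction n generalizing s with
  | zero => simp [pgfComp, Senv, walk, bEnv]
  | succ n ih =>
    rw [pgfComp_zero_succ, ih (hfrac.pgf_mem_Ico (by omega) ω hs), div_eq_mul_inv,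
      hfrac (n + 1) (by omega) ω s hs.1 hs.2]
    have hS : Senv Q (n + 1) ω = Senv Q n ω + Xenv Q (n + 1) ω := by
      simp [Senv, walk, Finset.sum_Icc_succ_top]
    have hb : bEnv Q (n + 1) ω
        = bEnv Q n ω + etaEnv Q (n + 1) ω * Real.exp (-(Senv Q n ω)) := by
      simp [bEnv, Finset.sum_range_succ]
    rw [hS, hb, neg_add, Real.exp_add]
    ring

lemma FracLinear.pgfComp_eq (hfrac : FracLinear Q) (n : ℕ) (ω : α) {s : ℝ}
    (hs : s ∈ Ico (0 : ℝ) 1) :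
    pgfComp Q 0 n ω s = 1 - (Real.exp (-(Senv Q n ω)) / (1 - s) + bEnv Q n ω)⁻¹ := by
  rw [← hfrac.inv_one_sub_pgfComp n ω hs, inv_inv]
  ring

lemma exp_div_add_bEnv_pos (Q : ℕ → α → Measure ℕ) (n : ℕ) (ω : α) {s : ℝ} (hs : s < 1) :
    0 < Real.exp (-(Senv Q n ω)) / (1 - s) + bEnv Q n ω :=
  add_pos_of_pos_of_nonneg (div_pos (Real.exp_pos _) (sub_pos.mpr hs)) (bEnv_nonneg Q n ω)

lemma FracLinear.continuousOn_pgfComp (hfrac : FracLinear Q) (n : ℕ) (ω : α) :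
    ContinuousOn (fun s => pgfComp Q 0 n ω s) (Ico 0 1) := by
  refine ContinuousOn.congr (f := fun s : ℝ =>
    1 - (Real.exp (-(Senv Q n ω)) / (1 - s) + bEnv Q n ω)⁻¹) ?_
    fun s hs => hfrac.pgfComp_eq n ω hs
  refine continuousOn_const.sub (ContinuousOn.inv₀ (ContinuousOn.add (ContinuousOn.div
    continuousOn_const (continuousOn_const.sub continuousOn_id) fun s hs => ?_)
    continuousOn_const) fun s hs => (exp_div_add_bEnv_pos Q n ω hs.2).ne')
  exact (sub_pos.mpr hs.2).ne'

lemma FracLinear.pgfComp_sub_pgfComp_zero (hfrac : FracLinear Q) (n : ℕ) (ω : α) {r : ℝ}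
    (hr : r ∈ Ico (0 : ℝ) 1) :
    pgfComp Q 0 n ω r - pgfComp Q 0 n ω 0 =
      (Real.exp (-(Senv Q n ω)) + bEnv Q n ω)⁻¹ *
        (Real.exp (-(Senv Q n ω)) / (1 - r) + bEnv Q n ω)⁻¹ *
        (r / (1 - r)) * Real.exp (-(Senv Q n ω)) := by
  rw [hfrac.pgfComp_eq n ω hr, hfrac.pgfComp_eq n ω ⟨le_rfl, zero_lt_one⟩]
  have h0 := exp_div_add_bEnv_pos Q n ω (zero_lt_one' ℝ)
  have h1 := exp_div_add_bEnv_pos Q n ω hr.2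
  have h2 : (1 - r) ≠ 0 := (sub_pos.mpr hr.2).ne'
  rw [sub_zero, div_one] at h0 ⊢
  generalize Real.exp (-(Senv Q n ω)) = a at *
  generalize bEnv Q n ω = b at *
  have h3 : r / (1 - r) * a = (a / (1 - r) + b) - (a + b) := by field_simp; ring
  rw [mul_assoc, h3]
  generalize a / (1 - r) + b = c at *
  field_simp
  ring

end FractionalLinear

lemma measurable_pgf_zero {α : Type*} {Q : ℕ → α → Measure ℕ} (n : ℕ) :
    Measurable[envSigma Q] fun ω => pgf Q (n + 1) ω 0 := by
  have hQ : Measurable[envSigma Q] (Q (n + 1)) :=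
    Measurable.of_comap_le (le_iSup (fun i => MeasurableSpace.comap (Q (i + 1)) inferInstance) n)
  simp_rw [pgf_zero]
  exact ((Measure.measurable_coe (measurableSet_singleton 0)).comp hQ).ennreal_toReal

lemma extinctTime_eq_succ_iff {α : Type*} {Z : ℕ → α → ℕ}
    (habs : ∀ n ω, Z n ω = 0 → Z (n + 1) ω = 0) (n : ℕ) (ω : α) :
    extinctTime Z ω = n + 1 ↔ Z n ω ≠ 0 ∧ Z (n + 1) ω = 0 := by
  have hmono : ∀ {i j : ℕ}, i ≤ j → Z i ω = 0 → Z j ω = 0 := fun hij hi =>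
    Nat.le_induction hi (fun j _ hj => habs j ω hj) _ hij
  constructor
  · intro h
    refine ⟨fun h0 => ?_, ?_⟩
    · have : extinctTime Z ω ≤ n := Nat.sInf_le h0
      omega
    · have hne : {k | Z k ω = 0}.Nonempty := Nat.nonempty_of_pos_sInf (by
        change 0 < extinctTime Z ω
        omega)
      have := Nat.sInf_mem hne
      change Z (extinctTime Z ω) ω = 0 at this
      rwa [h] at this
  · rintro ⟨h0, h1⟩
    refine le_antisymm (Nat.sInf_le h1) ?_
    by_contra hlt
    have := Nat.sInf_mem (s := {k | Z k ω = 0}) ⟨n + 1, h1⟩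
    exact h0 (hmono (Nat.lt_succ_iff.mp (not_le.mp hlt)) this)

/-- The probability generating function of `Z_n` at a random argument depending on the
environment only. -/
lemma BranchingProperty.integral_random_pow {μ : Measure Ω} [IsProbabilityMeasure μ]
    {Q : ℕ → Ω → Measure ℕ} {Z : ℕ → Ω → ℕ} (hbranch : BranchingProperty μ Q Z)
    (hQ : ∀ i, Measurable (Q i)) (hfrac : FracLinear Q) (n : ℕ) {r : Ω → ℝ}
    (hr : Measurable[envSigma Q] r) (hr01 : ∀ ω, r ω ∈ Ico (0 : ℝ) 1) :
    Integrable (fun ω => pgfComp Q 0 n ω (r ω)) μ ∧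
      ∫ ω, r ω ^ Z n ω ∂μ = ∫ ω, pgfComp Q 0 n ω (r ω) ∂μ := by
  obtain ⟨hZ0, hZm, -, hcond⟩ := hbranch
  have hE : envSigma Q ≤ ‹MeasurableSpace Ω› := iSup_le fun i => (hQ (i + 1)).comap_le
  have hm := sup_le hE (hZm 0).comap_le
  have hFG : ∀ v ∈ Ico (0 : ℝ) 1,
      μ[fun ω => v ^ Z n ω | envSigma Q ⊔ MeasurableSpace.comap (Z 0) inferInstance]
        =ᵐ[μ] fun ω => pgfComp Q 0 n ω v := by
    intro v hv
    simpa [hZ0] using hcond 0 n (Nat.zero_le n) v hv.1 hv.2.le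
  have hF : ∀ v ∈ Ico (0 : ℝ) 1, AEStronglyMeasurable (fun ω => v ^ Z n ω) μ := fun v _ =>
    ((measurable_of_countable fun k : ℕ => v ^ k).comp (hZm n)).aestronglyMeasurable
  have hG : ∀ v ∈ Ico (0 : ℝ) 1, AEStronglyMeasurable (fun ω => pgfComp Q 0 n ω v) μ :=
    fun v hv => integrable_condExp.aestronglyMeasurable.congr (hFG v hv)
  have hGb : ∀ v ∈ Ico (0 : ℝ) 1, ∀ ω, ‖pgfComp Q 0 n ω v‖ ≤ 1 := fun v hv ω => by
    have h := hfrac.pgfComp_mem_Ico n ω hv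
    rw [Real.norm_of_nonneg h.1]
    exact h.2.le
  have hFb : ∀ v ∈ Ico (0 : ℝ) 1, ∀ ω, ‖v ^ Z n ω‖ ≤ 1 := fun v hv ω => by
    rw [Real.norm_of_nonneg (pow_nonneg hv.1 _)]
    exact pow_le_one₀ hv.1 hv.2.le
  refine ⟨Integrable.of_bound (aestronglyMeasurable_comp_random
    (F := fun v ω => pgfComp Q 0 n ω v) hG (hfrac.continuousOn_pgfComp n)
    (hr.mono hE le_rfl) hr01) 1 (ae_of_all _ fun ω => hGb _ (hr01 ω) ω), ?_⟩
  exact integral_comp_random_eq (F := fun v ω => v ^ Z n ω)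
    (G := fun v ω => pgfComp Q 0 n ω v) hm hF hFb
    (fun ω => (continuous_pow (Z n ω)).continuousOn) hG hGb (hfrac.continuousOn_pgfComp n) hFG
    (hr.mono le_sup_left le_rfl) hr01

/-- One more generation: dying out at time `n + 1` means that all `Z_n ≥ 1` particles have no
children. -/
lemma BranchingProperty.setIntegral_extinctTime {μ : Measure Ω} [IsProbabilityMeasure μ]
    {Q : ℕ → Ω → Measure ℕ} {Z : ℕ → Ω → ℕ} (hbranch : BranchingProperty μ Q Z)
    (hQ : ∀ i, Measurable (Q i)) (n : ℕ) {s : ℝ} (hs0 : 0 ≤ s) (hs1 : s ≤ 1) :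
    ∫ ω in {ω | extinctTime Z ω = n + 1}, s ^ Z n ω ∂μ =
      ∫ ω, ((s * pgf Q (n + 1) ω 0) ^ Z n ω - (0 : ℝ) ^ Z n ω) ∂μ := by
  obtain ⟨-, hZm, habs, hcond⟩ := hbranch
  have hm : envSigma Q ⊔ MeasurableSpace.comap (Z n) inferInstance ≤ ‹MeasurableSpace Ω› :=
    sup_le (iSup_le fun i => (hQ (i + 1)).comap_le) (hZm n).comap_le
  set w : ℕ → ℝ := fun k => s ^ k - 0 ^ k * s ^ k with hw
  have hwZ : Measurable[envSigma Q ⊔ MeasurableSpace.comap (Z n) inferInstance]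
      fun ω => w (Z n ω) :=
    (measurable_of_countable w).comp
      (Measurable.of_comap_le (le_sup_right (a := envSigma Q)))
  have hwb : ∀ k, ‖w k‖ ≤ 1 := by
    intro k
    rcases eq_or_ne k 0 with rfl | hk
    · simp [hw]
    · simpa [hw, hk, abs_of_nonneg hs0] using pow_le_one₀ (n := k) hs0 hs1
  have hYint : Integrable (fun ω => (0 : ℝ) ^ Z (n + 1) ω) μ := by
    refine Integrable.of_bound ((measurable_of_countable fun k : ℕ => (0 : ℝ) ^ k).comp
      (hZm (n + 1))).aestronglyMeasurable 1 (ae_of_all _ fun ω => ?_)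
    rw [Real.norm_of_nonneg (by positivity)]
    exact pow_le_one₀ le_rfl zero_le_one
  have hprod : Integrable ((fun ω => w (Z n ω)) * fun ω => (0 : ℝ) ^ Z (n + 1) ω) μ :=
    hYint.bdd_mul (hwZ.mono hm le_rfl).aestronglyMeasurable (ae_of_all _ fun ω => hwb _)
  have hset : MeasurableSet {ω | extinctTime Z ω = n + 1} := by
    simp_rw [extinctTime_eq_succ_iff habs]
    exact ((hZm n) (measurableSet_singleton 0)).compl.inter
      ((hZm (n + 1)) (measurableSet_singleton 0))
  calc ∫ ω in {ω | extinctTime Z ω = n + 1}, s ^ Z n ω ∂μ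
      = ∫ ω, ((fun ω => w (Z n ω)) * fun ω => (0 : ℝ) ^ Z (n + 1) ω) ω ∂μ := by
        rw [← integral_indicator hset]
        refine integral_congr_ae (ae_of_all _ fun ω => ?_)
        by_cases h : Z n ω = 0 <;> by_cases h' : Z (n + 1) ω = 0 <;>
          simp [indicator, extinctTime_eq_succ_iff habs, hw, h, h']
    _ = ∫ ω, (μ[(fun ω => w (Z n ω)) * (fun ω => (0 : ℝ) ^ Z (n + 1) ω) |
          envSigma Q ⊔ MeasurableSpace.comap (Z n) inferInstance]) ω ∂μ :=
        (integral_condExp hm).symm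
    _ = ∫ ω, ((s * pgf Q (n + 1) ω 0) ^ Z n ω - (0 : ℝ) ^ Z n ω) ∂μ := by
        refine integral_congr_ae ?_
        filter_upwards [condExp_mul_of_stronglyMeasurable_left hwZ.stronglyMeasurable hprod hYint,
          hcond n (n + 1) n.le_succ 0 le_rfl zero_le_one] with ω h1 h2
        rw [h1, Pi.mul_apply, h2, pgfComp_self_succ]
        by_cases h : Z n ω = 0 <;> simp [hw, h, mul_pow]

/-- **The basic identity in the proof of Theorem 1.** For the fractional-linear BPRE
started from one particle, `E[s^{Z_n}; T = n+1] = E[Δ_n(s)]`, where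
`Δ_n(s) = f_{0,n}(s f(0)) - f_{0,n}(0)` (with `f = f_{n+1}`) admits the representation
`Δ_n(s) = (a_n + b_n)⁻¹ (a_n/(1 - s f(0)) + b_n)⁻¹ X_f(s) e^{-S_n}`,
`X_f(s) = s f(0)/(1 - s f(0))`. -/
theorem statement12
    {Ω : Type*} [MeasurableSpace Ω] (μ : Measure Ω) [IsProbabilityMeasure μ]
    (Q : ℕ → Ω → Measure ℕ) (Z : ℕ → Ω → ℕ)
    (hQprob : ∀ n ω, IsProbabilityMeasure (Q n ω))
    (hiid : IIDseq μ Q) (hfrac : FracLinear Q)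
    (hbranch : BranchingProperty μ Q Z) :
    ∀ n : ℕ, 1 ≤ n → ∀ s : ℝ, 0 ≤ s → s < 1 →
      (∫ ω in {ω | extinctTime Z ω = n + 1}, (s : ℝ) ^ Z n ω ∂μ =
        ∫ ω, (pgfComp Q 0 n ω (s * pgf Q (n + 1) ω 0) - pgfComp Q 0 n ω 0) ∂μ) ∧
      ∀ ω : Ω,
        pgfComp Q 0 n ω (s * pgf Q (n + 1) ω 0) - pgfComp Q 0 n ω 0 =
          (Real.exp (-(Senv Q n ω)) + bEnv Q n ω)⁻¹ *
            (Real.exp (-(Senv Q n ω)) / (1 - s * pgf Q (n + 1) ω 0) + bEnv Q n ω)⁻¹ *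
            (s * pgf Q (n + 1) ω 0 / (1 - s * pgf Q (n + 1) ω 0)) *
            Real.exp (-(Senv Q n ω)) := by
  intro n _ s hs0 hs1
  have hf : ∀ ω, pgf Q (n + 1) ω 0 ∈ Ico (0 : ℝ) 1 := fun ω =>
    hfrac.pgf_mem_Ico (by omega) ω ⟨le_rfl, zero_lt_one⟩
  have hr01 : ∀ ω, s * pgf Q (n + 1) ω 0 ∈ Ico (0 : ℝ) 1 := fun ω =>
    ⟨mul_nonneg hs0 (hf ω).1, mul_lt_one_of_nonneg_of_lt_one_left hs0 hs1 (hf ω).2.le⟩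
  refine ⟨?_, fun ω => hfrac.pgfComp_sub_pgfComp_zero n ω (hr01 ω)⟩
  have hr : Measurable[envSigma Q] fun ω => s * pgf Q (n + 1) ω 0 :=
    (measurable_pgf_zero n).const_mul s
  obtain ⟨hint, heq⟩ := hbranch.integral_random_pow hiid.1 hfrac n hr hr01
  obtain ⟨hint0, heq0⟩ := hbranch.integral_random_pow hiid.1 hfrac n
    (r := fun _ => 0) measurable_const fun _ => ⟨le_rfl, zero_lt_one⟩
  have hpow : ∀ r : Ω → ℝ, Measurable r → (∀ ω, r ω ∈ Ico (0 : ℝ) 1) →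
      Integrable (fun ω => r ω ^ Z n ω) μ := by
    intro r hrm hr1
    refine Integrable.of_bound (hrm.pow (hbranch.2.1 n)).aestronglyMeasurable 1
      (ae_of_all _ fun ω => ?_)
    rw [Real.norm_of_nonneg (pow_nonneg (hr1 ω).1 _)]
    exact pow_le_one₀ (hr1 ω).1 (hr1 ω).2.le
  have hE : envSigma Q ≤ ‹MeasurableSpace Ω› := iSup_le fun i => (hiid.1 (i + 1)).comap_le
  rw [hbranch.setIntegral_extinctTime hiid.1 n hs0 hs1.le,
    integral_sub (hpow _ (hr.mono hE le_rfl) hr01)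
      (hpow (fun _ => 0) measurable_const fun _ => ⟨le_rfl, zero_lt_one⟩),
    integral_sub hint hint0, heq, heq0]

end BPREpaper
end
end

section
/- Let S be a random walk with i.i.d. increments having zero mean, finite positive variance, and non-lattice distribution. Then: (i) for 0 < j < n, by duality, E[e^{2S_{τ(n)} − S_n}; τ(n) = j] = E[e^{S_j}; τ(j) = j] · E[e^{−S_{n−j}}; L_{n−j} ≥ 0]; and (ii) for every ε > 0 there exists N = N(ε) such that for all sufficiently large n ≥ 2N + 1, Σ_{j=N+1}^{n−N−1} E[e^{2S_{τ(n)} − S_n}; τ(n) = j] ≤ ε n^{−3/2}. -/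
open MeasureTheory ProbabilityTheory Filter Set Topology

noncomputable section

namespace BPREpaper

variable {Ω : Type*} [MeasurableSpace Ω]

/-- `x ^ (-1/2) * y ^ (-3/4) ≤ x ^ (-5/4) + y ^ (-5/4)`. -/
lemma rpow_mul_rpow_le_add {x y : ℝ} (hx : 0 < x) (hy : 0 < y) :
    x ^ (-(1 : ℝ) / 2) * y ^ (-(3 : ℝ) / 4) ≤ x ^ (-(5 : ℝ) / 4) + y ^ (-(5 : ℝ) / 4) := by
  have h1 : x ^ (-(5 : ℝ) / 4) = x ^ (-(1 : ℝ) / 2) * x ^ (-(3 : ℝ) / 4) := by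
    rw [← Real.rpow_add hx]; norm_num
  have h2 : y ^ (-(5 : ℝ) / 4) = y ^ (-(1 : ℝ) / 2) * y ^ (-(3 : ℝ) / 4) := by
    rw [← Real.rpow_add hy]; norm_num
  rcases le_total x y with h | h
  · have : y ^ (-(3 : ℝ) / 4) ≤ x ^ (-(3 : ℝ) / 4) :=
      Real.rpow_le_rpow_of_nonpos hx h (by norm_num)
    rw [h1]
    nlinarith [Real.rpow_pos_of_pos hx (-(1 : ℝ) / 2), Real.rpow_pos_of_pos hy (-(5 : ℝ) / 4)]
  · have : x ^ (-(1 : ℝ) / 2) ≤ y ^ (-(1 : ℝ) / 2) :=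
      Real.rpow_le_rpow_of_nonpos hy h (by norm_num)
    rw [h2]
    nlinarith [Real.rpow_pos_of_pos hy (-(3 : ℝ) / 4), Real.rpow_pos_of_pos hx (-(5 : ℝ) / 4)]

lemma rpow_mul_rpow_le_sum {x y : ℝ} (hx : 0 < x) (hy : 0 < y) :
    x ^ (-(1 : ℝ) / 2) * y ^ (-(5 : ℝ) / 4) ≤
      2 * (x ^ (-(5 : ℝ) / 4) + y ^ (-(5 : ℝ) / 4)) * (x + y) ^ (-(1 : ℝ) / 2) := by
  have hxy : 0 < x + y := add_pos hx hy
  have hs : (x + y) ^ ((1 : ℝ) / 2) ≤ x ^ ((1 : ℝ) / 2) + y ^ ((1 : ℝ) / 2) :=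
    Real.rpow_add_le_add_rpow hx.le hy.le (by norm_num) (by norm_num)
  have e1 : x ^ (-(1 : ℝ) / 2) * x ^ ((1 : ℝ) / 2) = 1 := by
    rw [← Real.rpow_add hx]; norm_num
  have e2 : y ^ (-(5 : ℝ) / 4) * y ^ ((1 : ℝ) / 2) = y ^ (-(3 : ℝ) / 4) := by
    rw [← Real.rpow_add hy]; norm_num
  have e3 : (x + y) ^ ((1 : ℝ) / 2) * (x + y) ^ (-(1 : ℝ) / 2) = 1 := by
    rw [← Real.rpow_add hxy]; norm_num
  have hx1 := Real.rpow_pos_of_pos hx (-(1 : ℝ) / 2)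
  have hx2 := Real.rpow_pos_of_pos hx (-(5 : ℝ) / 4)
  have hy1 := Real.rpow_pos_of_pos hy (-(5 : ℝ) / 4)
  have hz := Real.rpow_pos_of_pos hxy (-(1 : ℝ) / 2)
  calc x ^ (-(1 : ℝ) / 2) * y ^ (-(5 : ℝ) / 4)
      = x ^ (-(1 : ℝ) / 2) * y ^ (-(5 : ℝ) / 4) * (x + y) ^ ((1 : ℝ) / 2)
          * (x + y) ^ (-(1 : ℝ) / 2) := by rw [mul_assoc _ ((x + y) ^ ((1 : ℝ) / 2)), e3, mul_one]
    _ ≤ x ^ (-(1 : ℝ) / 2) * y ^ (-(5 : ℝ) / 4) * (x ^ ((1 : ℝ) / 2) + y ^ ((1 : ℝ) / 2))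
          * (x + y) ^ (-(1 : ℝ) / 2) := by gcongr
    _ = (y ^ (-(5 : ℝ) / 4) + x ^ (-(1 : ℝ) / 2) * y ^ (-(3 : ℝ) / 4))
          * (x + y) ^ (-(1 : ℝ) / 2) := by
        rw [← e2]; linear_combination y ^ (-(5 : ℝ) / 4) * (x + y) ^ (-(1 : ℝ) / 2) * e1
    _ ≤ _ := by
        gcongr
        linarith [rpow_mul_rpow_le_add hx hy]

lemma summable_succ_rpow {p : ℝ} (hp : p < -1) :
    Summable fun n : ℕ => ((n : ℝ) + 1) ^ p := by
  simpa using (summable_nat_add_iff 1).2 (Real.summable_nat_rpow.2 hp)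

open Finset in
lemma exists_antidiagonal_rpow_le :
    ∃ K : ℝ, 0 ≤ K ∧ ∀ n : ℕ, ∑ q ∈ antidiagonal n,
      ((q.1 : ℝ) + 1) ^ (-(1 : ℝ) / 2) * ((q.2 : ℝ) + 1) ^ (-(5 : ℝ) / 4)
        ≤ K * ((n : ℝ) + 2) ^ (-(1 : ℝ) / 2) := by
  have hs := summable_succ_rpow (p := -(5 : ℝ) / 4) (by norm_num)
  set T := ∑' n : ℕ, ((n : ℝ) + 1) ^ (-(5 : ℝ) / 4)
  have hT : ∀ n : ℕ, ∑ k ∈ range n, ((k : ℝ) + 1) ^ (-(5 : ℝ) / 4) ≤ T := fun n =>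
    hs.sum_le_tsum _ fun _ _ => by positivity
  refine ⟨4 * T, mul_nonneg (by norm_num) (tsum_nonneg fun _ => by positivity), fun n => ?_⟩
  have h1 : ∑ q ∈ antidiagonal n, ((q.1 : ℝ) + 1) ^ (-(5 : ℝ) / 4) ≤ T := by
    rw [Nat.sum_antidiagonal_eq_sum_range_succ_mk]; exact hT _
  have h2 : ∑ q ∈ antidiagonal n, ((q.2 : ℝ) + 1) ^ (-(5 : ℝ) / 4) ≤ T := by
    refine le_of_eq_of_le ?_ h1
    exact Finset.sum_nbij' Prod.swap Prod.swap (by simp [add_comm]) (by simp [add_comm])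
      (by simp) (by simp) (by simp)
  calc _ ≤ ∑ q ∈ antidiagonal n, 2 * (((q.1 : ℝ) + 1) ^ (-(5 : ℝ) / 4)
          + ((q.2 : ℝ) + 1) ^ (-(5 : ℝ) / 4)) * ((n : ℝ) + 2) ^ (-(1 : ℝ) / 2) := by
        refine sum_le_sum fun q hq => ?_
        have hn : (n : ℝ) + 2 = (q.1 + 1) + (q.2 + 1) := by
          rw [← mem_antidiagonal.1 hq]; push_cast; ring
        rw [hn]
        exact rpow_mul_rpow_le_sum (by positivity) (by positivity)
    _ = 2 * (∑ q ∈ antidiagonal n, ((q.1 : ℝ) + 1) ^ (-(5 : ℝ) / 4)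
          + ∑ q ∈ antidiagonal n, ((q.2 : ℝ) + 1) ^ (-(5 : ℝ) / 4))
          * ((n : ℝ) + 2) ^ (-(1 : ℝ) / 2) := by
        rw [← sum_add_distrib, mul_sum, sum_mul]
    _ ≤ _ := by
        have h3 : 2 * (∑ q ∈ antidiagonal n, ((q.1 : ℝ) + 1) ^ (-(5 : ℝ) / 4)
          + ∑ q ∈ antidiagonal n, ((q.2 : ℝ) + 1) ^ (-(5 : ℝ) / 4)) ≤ 4 * T := by linarith
        gcongr

open Finset in
/-- If `n B n = ∑ b k B (n - k)` (with `b k = O(k^{-1/2})`), then the coefficients of `B` are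
`O(n^{-3/2})`. -/
theorem exists_le_rpow_of_recursion {B b : ℕ → ℝ} {C : ℝ} (hB : ∀ n, 0 ≤ B n)
    (hb : ∀ k : ℕ, b (k + 1) ≤ C * ((k : ℝ) + 1) ^ (-(1 : ℝ) / 2))
    (hrec : ∀ n : ℕ, ((n : ℝ) + 1) * B (n + 1) = ∑ q ∈ antidiagonal n, b (q.1 + 1) * B q.2) :
    ∃ D : ℝ, 0 ≤ D ∧ ∀ n : ℕ, B (n + 1) ≤ D * ((n : ℝ) + 1) ^ (-(3 : ℝ) / 2) := by
  wlog hC : 0 ≤ C generalizing C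
  · refine this (C := 0) (fun k => (hb k).trans ?_) le_rfl
    have : (0 : ℝ) ≤ ((k : ℝ) + 1) ^ (-(1 : ℝ) / 2) := by positivity
    nlinarith
  obtain ⟨K, hK, hsum⟩ := exists_antidiagonal_rpow_le
  have step : ∀ (D : ℝ), 0 ≤ D → ∀ n : ℕ,
      (∀ m ≤ n, B m ≤ D * ((m : ℝ) + 1) ^ (-(5 : ℝ) / 4)) →
      B (n + 1) ≤ C * D * K * ((n : ℝ) + 2) ^ (-(1 : ℝ) / 2) / ((n : ℝ) + 1) := by
    intro D hD n h
    rw [le_div_iff₀ (by positivity), mul_comm, hrec]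
    calc _ ≤ ∑ q ∈ antidiagonal n, C * D * (((q.1 : ℝ) + 1) ^ (-(1 : ℝ) / 2)
            * ((q.2 : ℝ) + 1) ^ (-(5 : ℝ) / 4)) := by
          refine sum_le_sum fun q hq => ?_
          have hq' : q.2 ≤ n := by have := mem_antidiagonal.1 hq; omega
          calc b (q.1 + 1) * B q.2 ≤ (C * ((q.1 : ℝ) + 1) ^ (-(1 : ℝ) / 2))
                * (D * ((q.2 : ℝ) + 1) ^ (-(5 : ℝ) / 4)) := by
                refine (mul_le_mul_of_nonneg_right (hb _) (hB _)).trans ?_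
                exact mul_le_mul_of_nonneg_left (h _ hq') (by positivity)
            _ = _ := by ring
      _ ≤ C * D * (K * ((n : ℝ) + 2) ^ (-(1 : ℝ) / 2)) := by
          rw [← mul_sum]
          exact mul_le_mul_of_nonneg_left (hsum n) (by positivity)
      _ = _ := by ring
  obtain ⟨n₀, hn₀⟩ : ∃ n₀ : ℕ, ∀ n : ℕ, n₀ ≤ n → 2 * C * K ≤ ((n : ℝ) + 2) ^ ((1 : ℝ) / 4) := by
    have : Tendsto (fun n : ℕ => ((n : ℝ) + 2) ^ ((1 : ℝ) / 4)) atTop atTop :=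
      (tendsto_rpow_atTop (by norm_num)).comp
        (tendsto_atTop_add_const_right _ _ tendsto_natCast_atTop_atTop)
    exact eventually_atTop.1 (this.eventually_ge_atTop _)
  set D := ∑ m ∈ range (n₀ + 1), B m * ((m : ℝ) + 1) ^ ((5 : ℝ) / 4) with hDdef
  have hD : 0 ≤ D := sum_nonneg fun m _ => mul_nonneg (hB m) (by positivity)
  have hbase : ∀ m ≤ n₀, B m ≤ D * ((m : ℝ) + 1) ^ (-(5 : ℝ) / 4) := by
    intro m hm
    have h1 : B m * ((m : ℝ) + 1) ^ ((5 : ℝ) / 4) ≤ D :=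
      single_le_sum (f := fun m : ℕ => B m * ((m : ℝ) + 1) ^ ((5 : ℝ) / 4))
        (fun m _ => mul_nonneg (hB m) (by positivity)) (mem_range.2 (by omega))
    have h2 : ((m : ℝ) + 1) ^ ((5 : ℝ) / 4) * ((m : ℝ) + 1) ^ (-(5 : ℝ) / 4) = 1 := by
      rw [← Real.rpow_add (by positivity)]; norm_num
    calc B m = B m * ((m : ℝ) + 1) ^ ((5 : ℝ) / 4) * ((m : ℝ) + 1) ^ (-(5 : ℝ) / 4) := by
          rw [mul_assoc, h2, mul_one]
      _ ≤ _ := by gcongr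
  have hdiv : ∀ n : ℕ, ((n : ℝ) + 2) ^ (-(1 : ℝ) / 2) / ((n : ℝ) + 1)
      ≤ 2 * ((n : ℝ) + 2) ^ (-(3 : ℝ) / 2) := by
    intro n
    have h : ((n : ℝ) + 2) ^ (-(1 : ℝ) / 2) = ((n : ℝ) + 2) ^ (-(3 : ℝ) / 2) * ((n : ℝ) + 2) := by
      rw [← Real.rpow_add_one (by positivity)]; norm_num
    rw [div_le_iff₀ (by positivity), h]
    have : (0 : ℝ) < ((n : ℝ) + 2) ^ (-(3 : ℝ) / 2) := by positivity
    nlinarith [(Nat.cast_nonneg n : (0 : ℝ) ≤ n)]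
  have hall : ∀ n : ℕ, B n ≤ D * ((n : ℝ) + 1) ^ (-(5 : ℝ) / 4) := by
    intro n
    induction n using Nat.strong_induction_on with
    | _ n ih =>
      rcases le_or_gt n n₀ with h | h
      · exact hbase n h
      · obtain ⟨m, rfl⟩ : ∃ m, n = m + 1 := ⟨n - 1, by omega⟩
        have h1 := step D hD m fun k hk => ih k (by omega)
        have h2 := hn₀ m (by omega)
        have h3 : ((m : ℝ) + 2) ^ (-(5 : ℝ) / 4)
            = ((m : ℝ) + 2) ^ ((1 : ℝ) / 4) * ((m : ℝ) + 2) ^ (-(3 : ℝ) / 2) := by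
          rw [← Real.rpow_add (by positivity)]; norm_num
        have h4 : ((m + 1 : ℕ) : ℝ) + 1 = m + 2 := by push_cast; ring
        calc B (m + 1) ≤ C * D * K * (((m : ℝ) + 2) ^ (-(1 : ℝ) / 2) / ((m : ℝ) + 1)) := by
              rw [← mul_div_assoc]; exact h1
          _ ≤ C * D * K * (2 * ((m : ℝ) + 2) ^ (-(3 : ℝ) / 2)) := by
              gcongr; exact hdiv m
          _ = D * ((2 * C * K) * ((m : ℝ) + 2) ^ (-(3 : ℝ) / 2)) := by ring
          _ ≤ _ := by rw [h4, h3]; gcongr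
  refine ⟨C * D * K * 2, by positivity, fun n => ?_⟩
  calc B (n + 1) ≤ C * D * K * (((n : ℝ) + 2) ^ (-(1 : ℝ) / 2) / ((n : ℝ) + 1)) := by
        rw [← mul_div_assoc]; exact step D hD n fun m _ => hall m
    _ ≤ C * D * K * (2 * ((n : ℝ) + 2) ^ (-(3 : ℝ) / 2)) := by
        gcongr; exact hdiv n
    _ ≤ C * D * K * (2 * ((n : ℝ) + 1) ^ (-(3 : ℝ) / 2)) := by
        gcongr ?_ * (2 * ?_)
        exact Real.rpow_le_rpow_of_nonpos (by positivity) (by linarith) (by norm_num)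
    _ = _ := by ring

/-- The middle part of the convolution of `k^{-3/2}` with itself is small. -/
theorem exists_sum_middle_le {a : ℕ → ℕ → ℝ} {D : ℝ} (hD : 0 ≤ D)
    (ha : ∀ j n : ℕ, 0 < j → j < n →
      a j n ≤ D * ((j : ℝ) ^ (-(3 : ℝ) / 2) * ((n - j : ℕ) : ℝ) ^ (-(3 : ℝ) / 2)))
    {ε : ℝ} (hε : 0 < ε) :
    ∃ N : ℕ, ∀ n : ℕ, 2 * N + 1 ≤ n →
      ∑ j ∈ Finset.Icc (N + 1) (n - N - 1), a j n ≤ ε * (n : ℝ) ^ (-(3 : ℝ) / 2) := by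
  have hs : Summable fun n : ℕ => (n : ℝ) ^ (-(3 : ℝ) / 2) :=
    Real.summable_nat_rpow.2 (by norm_num)
  set M : ℝ := 2 * (2 : ℝ) ^ ((3 : ℝ) / 2) with hM
  have hM0 : 0 < M := by positivity
  obtain ⟨N, hN⟩ : ∃ N : ℕ, ∀ m : ℕ,
      ∑ j ∈ Finset.Icc (N + 1) m, (j : ℝ) ^ (-(3 : ℝ) / 2) ≤ ε / (D * M + 1) := by
    have ht := tendsto_sum_nat_add fun n : ℕ => (n : ℝ) ^ (-(3 : ℝ) / 2)
    obtain ⟨N, hN⟩ := eventually_atTop.1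
      (ht.eventually_le_const (show (0 : ℝ) < ε / (D * M + 1) by positivity))
    refine ⟨N, fun m => le_trans ?_ (hN (N + 1) (by omega))⟩
    have hs' := (summable_nat_add_iff (N + 1)).2 hs
    rw [show Finset.Icc (N + 1) m = (Finset.range (m - N)).map (addRightEmbedding (N + 1)) by
      ext j
      simp only [Finset.mem_Icc, Finset.mem_map, Finset.mem_range, addRightEmbedding_apply]
      exact ⟨fun h => ⟨j - (N + 1), by omega, by omega⟩, fun ⟨i, h1, h2⟩ => by omega⟩,
      Finset.sum_map]
    exact hs'.sum_le_tsum _ fun _ _ => by positivity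
  refine ⟨N, fun n hn => ?_⟩
  have hn0 : (0 : ℝ) < n := by exact_mod_cast (by omega : 0 < n)
  have key : ∀ j ∈ Finset.Icc (N + 1) (n - N - 1), a j n ≤
      D * ((2 : ℝ) ^ ((3 : ℝ) / 2) * (n : ℝ) ^ (-(3 : ℝ) / 2)) *
        ((j : ℝ) ^ (-(3 : ℝ) / 2) + ((n - j : ℕ) : ℝ) ^ (-(3 : ℝ) / 2)) := by
    intro j hj
    rw [Finset.mem_Icc] at hj
    refine (ha j n (by omega) (by omega)).trans ?_
    rw [mul_assoc]
    refine mul_le_mul_of_nonneg_left ?_ hD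
    have e : (2 : ℝ) ^ ((3 : ℝ) / 2) * (n : ℝ) ^ (-(3 : ℝ) / 2)
        = ((n : ℝ) / 2) ^ (-(3 : ℝ) / 2) := by
      rw [Real.div_rpow hn0.le (by norm_num), neg_div, Real.rpow_neg (by norm_num : (0 : ℝ) ≤ 2),
        div_inv_eq_mul, mul_comm]
    rw [e]
    have hc : (j : ℝ) + ((n - j : ℕ) : ℝ) = n := by
      rw [← Nat.cast_add]; congr 1; omega
    have hj0 : (0 : ℝ) < j := by exact_mod_cast (by omega : 0 < j)
    have hj1 : (0 : ℝ) < (n - j : ℕ) := by exact_mod_cast (by omega : 0 < n - j)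
    have p1 : (0 : ℝ) < (j : ℝ) ^ (-(3 : ℝ) / 2) := by positivity
    have p2 : (0 : ℝ) < ((n - j : ℕ) : ℝ) ^ (-(3 : ℝ) / 2) := by positivity
    have p3 : (0 : ℝ) < ((n : ℝ) / 2) ^ (-(3 : ℝ) / 2) := by positivity
    rcases le_total ((n : ℝ) / 2) j with h | h
    · have := Real.rpow_le_rpow_of_nonpos (by positivity) h (by norm_num : -(3 : ℝ) / 2 ≤ 0)
      nlinarith
    · have := Real.rpow_le_rpow_of_nonpos (by positivity)
        (by linarith : (n : ℝ) / 2 ≤ (n - j : ℕ)) (by norm_num : -(3 : ℝ) / 2 ≤ 0)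
      nlinarith
  have hrefl : ∑ j ∈ Finset.Icc (N + 1) (n - N - 1), ((n - j : ℕ) : ℝ) ^ (-(3 : ℝ) / 2)
      = ∑ j ∈ Finset.Icc (N + 1) (n - N - 1), (j : ℝ) ^ (-(3 : ℝ) / 2) := by
    refine Finset.sum_nbij' (fun j => n - j) (fun j => n - j) ?_ ?_ ?_ ?_ fun _ _ => rfl <;>
      intro j hj <;> simp only [Finset.mem_Icc] at * <;> omega
  calc _ ≤ _ := Finset.sum_le_sum key
    _ = D * ((2 : ℝ) ^ ((3 : ℝ) / 2) * (n : ℝ) ^ (-(3 : ℝ) / 2)) *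
        (2 * ∑ j ∈ Finset.Icc (N + 1) (n - N - 1), (j : ℝ) ^ (-(3 : ℝ) / 2)) := by
      rw [← Finset.mul_sum, Finset.sum_add_distrib, hrefl, two_mul]
    _ ≤ D * ((2 : ℝ) ^ ((3 : ℝ) / 2) * (n : ℝ) ^ (-(3 : ℝ) / 2)) *
        (2 * (ε / (D * M + 1))) := by gcongr; exact hN _
    _ = (D * M / (D * M + 1)) * ε * (n : ℝ) ^ (-(3 : ℝ) / 2) := by rw [hM]; ring
    _ ≤ 1 * ε * (n : ℝ) ^ (-(3 : ℝ) / 2) := by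
      gcongr
      rw [div_le_one (by positivity)]; linarith
    _ = _ := by rw [one_mul]

/-- Near the origin, the characteristic function of a centered non-degenerate law with finite
variance is dominated by a Gaussian. -/
lemma exists_norm_charFun_le_exp {ν : Measure ℝ} [IsProbabilityMeasure ν]
    (hmean : ∫ x, x ∂ν = 0) (hsq : Integrable (fun x => x ^ 2) ν) (hvar : 0 < ∫ x, x ^ 2 ∂ν) :
    ∃ c δ : ℝ, 0 < c ∧ 0 < δ ∧ δ ≤ 1 ∧
      ∀ t : ℝ, 0 ≤ t → t ≤ δ → ‖charFun ν t‖ ≤ Real.exp (-c * t ^ 2) := by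
  set V := ∫ x, x ^ 2 ∂ν with hV
  have hint : MemLp id 2 ν := (memLp_two_iff_integrable_sq (by fun_prop)).2 hsq
  have htaylor : (fun t : ℝ => charFun ν t - (1 - V * t ^ 2 / 2)) =o[𝓝 0]
      fun t : ℝ => t ^ 2 := by
    have h := taylor_isLittleO_univ (x₀ := 0) (contDiff_charFun (n := 2) hint)
    simp only [sub_zero] at h
    refine h.congr_left fun t => ?_
    rw [taylorWithinEval_charFun_zero hint t]
    norm_num [Finset.sum_range_succ, hmean, ← hV, Nat.factorial]
    rw [mul_pow, Complex.I_sq]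
    ring
  have h1 := htaylor.bound (show (0 : ℝ) < V / 4 by positivity)
  obtain ⟨r, hr, hball⟩ := Metric.eventually_nhds_iff.1 h1
  have hV0 : (0 : ℝ) < V + 1 := by positivity
  refine ⟨V / 4, min (r / 2) (1 / (V + 1)), by positivity, by positivity, ?_, fun t ht0 ht => ?_⟩
  · refine (min_le_right _ _).trans ?_
    rw [div_le_one hV0]; linarith
  have ht1 : t ≤ r / 2 := ht.trans (min_le_left _ _)
  have ht2 : t ≤ 1 / (V + 1) := ht.trans (min_le_right _ _)
  have hVt : V * t ^ 2 ≤ 1 := by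
    rw [le_div_iff₀ hV0] at ht2
    nlinarith
  have hb := hball (y := t) (by rw [Real.dist_eq, sub_zero, abs_of_nonneg ht0]; linarith)
  have hn : ‖(1 - V * t ^ 2 / 2 : ℂ)‖ = 1 - V * t ^ 2 / 2 := by
    rw [show (1 - V * t ^ 2 / 2 : ℂ) = ((1 - V * t ^ 2 / 2 : ℝ) : ℂ) by push_cast; ring,
      Complex.norm_real, Real.norm_of_nonneg (by linarith)]
  have h2 : ‖charFun ν t‖ ≤ V / 4 * t ^ 2 + (1 - V * t ^ 2 / 2) := by
    rw [Real.norm_of_nonneg (sq_nonneg t)] at hb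
    calc ‖charFun ν t‖ = ‖(charFun ν t - (1 - V * t ^ 2 / 2)) + (1 - V * t ^ 2 / 2)‖ := by
          rw [sub_add_cancel]
      _ ≤ _ := (norm_add_le _ _).trans (by rw [hn]; gcongr)
  have := Real.add_one_le_exp (-(V / 4) * t ^ 2)
  linarith

/-- The Fejér kernel `∫₀^δ (δ - t) cos (t x) dt`. -/
def fejer (δ x : ℝ) : ℝ := ∫ t in (0 : ℝ)..δ, (δ - t) * Real.cos (t * x)

lemma fejer_nonneg {δ : ℝ} (hδ : 0 < δ) (x : ℝ) : 0 ≤ fejer δ x := by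
  rcases eq_or_ne x 0 with rfl | hx
  · refine intervalIntegral.integral_nonneg hδ.le fun t ht => ?_
    simpa using ht.2
  · have hd : ∀ t ∈ uIcc 0 δ, HasDerivAt
        (fun t => (δ - t) * (Real.sin (t * x) / x) - Real.cos (t * x) / x ^ 2)
        ((δ - t) * Real.cos (t * x)) t := by
      intro t _
      have h1 : HasDerivAt (fun t : ℝ => t * x) x t := hasDerivAt_mul_const x
      have h2 := (((hasDerivAt_id t).const_sub δ).mul (h1.sin.div_const x)).sub
        (h1.cos.div_const (x ^ 2))
      refine h2.congr_deriv ?_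
      simp only [id]
      field_simp
      ring
    rw [fejer, intervalIntegral.integral_eq_sub_of_hasDerivAt hd
      (by apply Continuous.intervalIntegrable; fun_prop)]
    have : 0 ≤ (1 - Real.cos (δ * x)) / x ^ 2 :=
      div_nonneg (sub_nonneg.2 (Real.cos_le_one _)) (sq_nonneg x)
    simp
    rw [sub_div, one_div] at this
    linarith

lemma le_fejer {δ x : ℝ} (hδ : 0 < δ) (hδ1 : δ ≤ 1) (hx : |x| ≤ 1) : δ ^ 2 / 4 ≤ fejer δ x := by
  have hi : ∫ t in (0 : ℝ)..δ, (δ - t) * (1 / 2) = δ ^ 2 / 4 := by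
    rw [intervalIntegral.integral_mul_const, intervalIntegral.integral_sub (by simp) (by simp)]
    simp
    ring
  rw [← hi, fejer]
  refine intervalIntegral.integral_mono_on hδ.le ?_ ?_ fun t ht => ?_
  · apply Continuous.intervalIntegrable; fun_prop
  · apply Continuous.intervalIntegrable; fun_prop
  refine mul_le_mul_of_nonneg_left ?_ (by linarith [ht.2])
  have habs : |t * x| ≤ 1 := by
    rw [abs_mul, abs_of_nonneg ht.1]
    nlinarith [ht.1, ht.2, abs_nonneg x]
  have h := Real.one_sub_sq_div_two_le_cos (x := t * x)
  have : (t * x) ^ 2 ≤ 1 := (sq_le_one_iff_abs_le_one _).2 habs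
  linarith

lemma continuous_fejer (δ : ℝ) : Continuous (fejer δ) := by
  unfold fejer
  apply intervalIntegral.continuous_parametric_intervalIntegral_of_continuous' (by fun_prop)

lemma abs_fejer_le {δ : ℝ} (hδ : 0 < δ) (x : ℝ) : |fejer δ x| ≤ δ * δ := by
  have := intervalIntegral.norm_integral_le_of_norm_le_const (a := 0) (b := δ) (C := δ)
    (f := fun t => (δ - t) * Real.cos (t * x)) fun t ht => by
      rw [uIoc_of_le hδ.le] at ht
      rw [norm_mul, Real.norm_of_nonneg (by linarith [ht.2]), Real.norm_eq_abs]
      nlinarith [Real.abs_cos_le_one (t * x), abs_nonneg (Real.cos (t * x)), ht.1, ht.2]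
  simpa [fejer, abs_of_pos hδ] using this

/-- **Esseen's concentration inequality** (on unit scale). -/
lemma measureReal_Icc_le_integral_norm_charFun {ρ : Measure ℝ} [IsProbabilityMeasure ρ] {δ : ℝ}
    (hδ : 0 < δ) (hδ1 : δ ≤ 1) (y : ℝ) :
    ρ.real (Icc (y - 1) (y + 1)) ≤ 4 / δ * ∫ t in (0 : ℝ)..δ, ‖charFun ρ t‖ := by
  have hcont : Continuous fun x => fejer δ (x - y) := (continuous_fejer δ).comp (by fun_prop)
  have hintf : Integrable (fun x => fejer δ (x - y)) ρ :=
    (integrable_const (δ * δ)).mono' hcont.aestronglyMeasurable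
      (ae_of_all _ fun x => abs_fejer_le hδ _)
  have hlow : δ ^ 2 / 4 * ρ.real (Icc (y - 1) (y + 1)) ≤ ∫ x, fejer δ (x - y) ∂ρ := by
    calc δ ^ 2 / 4 * ρ.real (Icc (y - 1) (y + 1))
        = ∫ x in Icc (y - 1) (y + 1), δ ^ 2 / 4 ∂ρ := by
          rw [setIntegral_const, smul_eq_mul, mul_comm]
      _ ≤ ∫ x in Icc (y - 1) (y + 1), fejer δ (x - y) ∂ρ := by
          refine setIntegral_mono_on (by simp) hintf.integrableOn measurableSet_Icc fun x hx => ?_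
          exact le_fejer hδ hδ1 (abs_le.2 ⟨by linarith [hx.1], by linarith [hx.2]⟩)
      _ ≤ _ := setIntegral_le_integral hintf (ae_of_all _ fun x => fejer_nonneg hδ _)
  have hcos : ∀ t : ℝ, ∫ x, Real.cos (t * (x - y)) ∂ρ ≤ ‖charFun ρ t‖ := by
    intro t
    have hI : Integrable (fun x : ℝ => Complex.exp (t * x * Complex.I)) ρ := by
      refine (integrable_const (1 : ℝ)).mono' (by fun_prop) (ae_of_all _ fun x => ?_)
      rw [← Complex.ofReal_mul, Complex.norm_exp_ofReal_mul_I]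
    have h1 : ∫ x, Real.cos (t * (x - y)) ∂ρ
        = (Complex.exp ((-(t * y) : ℝ) * Complex.I) * charFun ρ t).re := by
      rw [charFun_apply_real, ← integral_const_mul]
      have := integral_re (hI.const_mul (Complex.exp ((-(t * y) : ℝ) * Complex.I)))
      simp only [RCLike.re_to_complex] at this
      rw [← this]
      refine integral_congr_ae (ae_of_all _ fun x => ?_)
      simp only
      rw [← Complex.exp_add, ← Complex.exp_ofReal_mul_I_re]
      congr 2
      push_cast
      ring
    rw [h1]
    refine (Complex.re_le_norm _).trans ?_
    rw [norm_mul, Complex.norm_exp_ofReal_mul_I, one_mul]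
  have hup : ∫ x, fejer δ (x - y) ∂ρ ≤ δ * ∫ t in (0 : ℝ)..δ, ‖charFun ρ t‖ := by
    have hswap : ∫ x, fejer δ (x - y) ∂ρ
        = ∫ t in (0 : ℝ)..δ, (δ - t) * ∫ x, Real.cos (t * (x - y)) ∂ρ := by
      simp_rw [fejer, intervalIntegral.integral_of_le hδ.le, ← integral_const_mul]
      refine integral_integral_swap ?_
      rw [← Measure.restrict_univ (μ := ρ), Measure.prod_restrict]
      refine Measure.integrableOn_of_bounded (M := δ) ?_ ?_ ?_
      · simp [Measure.prod_prod]
      · exact (by unfold Function.uncurry; fun_prop : Continuous _).aestronglyMeasurable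
      · rw [ae_restrict_iff' (MeasurableSet.univ.prod measurableSet_Ioc)]
        refine ae_of_all _ fun p hp => ?_
        have h2 := hp.2
        simp only [Function.uncurry]
        rw [norm_mul, Real.norm_of_nonneg (by linarith [h2.2]), Real.norm_eq_abs]
        nlinarith [Real.abs_cos_le_one (p.2 * (p.1 - y)),
          abs_nonneg (Real.cos (p.2 * (p.1 - y))), h2.1, h2.2]
    rw [hswap, ← intervalIntegral.integral_const_mul]
    refine intervalIntegral.integral_mono_on hδ.le ?_ ?_ fun t ht => ?_
    · refine (Continuous.intervalIntegrable ?_ _ _)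
      refine (by fun_prop : Continuous fun t : ℝ => δ - t).mul ?_
      refine continuous_of_dominated (bound := fun _ => 1) (fun t => ?_) (fun t => ?_)
        (integrable_const _) (ae_of_all _ fun x => by fun_prop)
      · exact (by fun_prop : Continuous _).aestronglyMeasurable
      · exact ae_of_all _ fun x => Real.abs_cos_le_one _
    · exact (continuous_const.mul continuous_charFun.norm).intervalIntegrable _ _
    · exact (mul_le_mul_of_nonneg_left (hcos t) (by linarith [ht.2])).trans
        (mul_le_mul_of_nonneg_right (by linarith [ht.1]) (norm_nonneg _))
  have h3 := hlow.trans hup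
  rw [div_mul_eq_mul_div, le_div_iff₀ hδ]
  nlinarith

lemma integral_exp_neg_mul_sq_le {c δ : ℝ} (hc : 0 < c) (hδ : 0 < δ) :
    ∫ t in (0 : ℝ)..δ, Real.exp (-c * t ^ 2) ≤ √(Real.pi / c) := by
  rw [intervalIntegral.integral_of_le hδ.le]
  calc _ ≤ ∫ t in Ioi (0 : ℝ), Real.exp (-c * t ^ 2) :=
        setIntegral_mono_set (integrable_exp_neg_mul_sq hc).integrableOn
          (ae_of_all _ fun _ => (Real.exp_pos _).le) Ioc_subset_Ioi_self.eventuallyLE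
    _ ≤ _ := by
        rw [integral_gaussian_Ioi]
        linarith [Real.sqrt_nonneg (Real.pi / c)]

/-- A measure that puts mass at most `Q` on each interval of length two integrates `e^{-|x|}`
to at most a multiple of `Q`. -/
lemma integral_exp_neg_abs_le {ρ : Measure ℝ} [IsProbabilityMeasure ρ] {Q : ℝ}
    (h : ∀ y : ℝ, ρ.real (Icc (y - 1) (y + 1)) ≤ Q) :
    ∫ x, Real.exp (-|x|) ∂ρ ≤ Q * (2 * ∑' m : ℕ, Real.exp (-m)) := by
  have hQ : 0 ≤ Q := measureReal_nonneg.trans (h 0)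
  have hs : Summable fun m : ℕ => Real.exp (-m) := Real.summable_exp_neg_nat
  set I : ℝ → ℝ → ℝ := fun y => (Icc (y - 1) (y + 1)).indicator 1 with hI
  have hIint : ∀ y, Integrable (I y) ρ := fun y =>
    (integrable_const (1 : ℝ)).indicator measurableSet_Icc
  have hIval : ∀ y, ∫ x, I y x ∂ρ ≤ Q := fun y => by
    rw [hI, integral_indicator_one measurableSet_Icc]; exact h y
  have hI0 : ∀ y x, 0 ≤ I y x := fun y x => indicator_nonneg (fun _ _ => zero_le_one) _
  have hI1 : ∀ y x, I y x ≤ 1 := fun y x => indicator_le_self' (fun _ _ => zero_le_one) _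
  set F : ℕ → ℝ → ℝ := fun m x => Real.exp (-m) * (I m x + I (-m) x) with hF
  have hFint : ∀ m, Integrable (F m) ρ := fun m => ((hIint _).add (hIint _)).const_mul _
  have hFval : ∀ m, ∫ x, F m x ∂ρ ≤ Real.exp (-m) * (2 * Q) := fun m => by
    rw [hF]
    simp only
    rw [integral_const_mul, integral_add (hIint _) (hIint _)]
    have := hIval m
    have := hIval (-m)
    gcongr
    linarith
  have hF0 : ∀ m x, 0 ≤ F m x := fun m x =>
    mul_nonneg (Real.exp_pos _).le (add_nonneg (hI0 _ _) (hI0 _ _))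
  have hFle : ∀ m x, F m x ≤ Real.exp (-m) * 2 := fun m x => by
    rw [hF]
    simp only
    have := hI1 m x
    have := hI1 (-m) x
    gcongr
    linarith
  have hsumF : Summable fun m => ∫ x, ‖F m x‖ ∂ρ := by
    refine (hs.mul_right (2 * Q)).of_nonneg_of_le (fun m => integral_nonneg fun _ => norm_nonneg _)
      fun m => ?_
    simp_rw [Real.norm_of_nonneg (hF0 _ _)]
    exact hFval m
  have hdom : ∀ x, Real.exp (-|x|) ≤ ∑' m, F m x := by
    intro x
    have hsx : Summable fun m => F m x :=
      (hs.mul_right 2).of_nonneg_of_le (fun m => hF0 m x) fun m => hFle m x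
    refine le_trans ?_ (hsx.le_tsum ⌊|x|⌋₊ fun m _ => hF0 m x)
    have h1 := Nat.floor_le (abs_nonneg x)
    have h2 := Nat.lt_floor_add_one |x|
    have hone : 1 ≤ I ⌊|x|⌋₊ x + I (-⌊|x|⌋₊) x := by
      rcases le_total 0 x with hx | hx
      · have : I ⌊|x|⌋₊ x = 1 := indicator_of_mem (by
          rw [abs_of_nonneg hx] at *; constructor <;> linarith) _
        linarith [hI0 (-⌊|x|⌋₊) x]
      · have : I (-⌊|x|⌋₊) x = 1 := indicator_of_mem (by
          rw [abs_of_nonpos hx] at *; constructor <;> linarith) _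
        linarith [hI0 ⌊|x|⌋₊ x]
    calc Real.exp (-|x|) ≤ Real.exp (-(⌊|x|⌋₊ : ℝ)) := by gcongr
      _ ≤ _ := le_mul_of_one_le_right (Real.exp_pos _).le hone
  have hFs := hasSum_integral_of_summable_integral_norm hFint hsumF
  have hmeas : Integrable (fun x => ∑' m, F m x) ρ := by
    refine (integrable_const ((∑' m : ℕ, Real.exp (-m)) * 2)).mono' ?_ (ae_of_all _ fun x => ?_)
    · refine (Measurable.aestronglyMeasurable ?_)
      refine Measurable.tsum fun m => ?_
      refine measurable_const.mul (Measurable.add ?_ ?_) <;>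
        exact measurable_const.indicator measurableSet_Icc
    · rw [Real.norm_of_nonneg (tsum_nonneg fun m => hF0 m x), ← tsum_mul_right]
      exact ((hs.mul_right 2).of_nonneg_of_le (fun m => hF0 m x) fun m => hFle m x).tsum_le_tsum
        (fun m => hFle m x) (hs.mul_right 2)
  calc ∫ x, Real.exp (-|x|) ∂ρ ≤ ∫ x, ∑' m, F m x ∂ρ := by
        refine integral_mono_of_nonneg (ae_of_all _ fun _ => (Real.exp_pos _).le) hmeas
          (ae_of_all _ hdom)
    _ = ∑' m, ∫ x, F m x ∂ρ := hFs.tsum_eq.symm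
    _ ≤ ∑' m : ℕ, Real.exp (-m) * (2 * Q) :=
        hFs.summable.tsum_le_tsum hFval (hs.mul_right _)
    _ = _ := by rw [tsum_mul_right]; ring

/-- `E e^{-|S_k|} = O(k^{-1/2})` for a random walk with centered, square integrable,
non-degenerate steps. -/
theorem exists_integral_exp_neg_abs_le {ν : Measure ℝ} [IsProbabilityMeasure ν]
    (hmean : ∫ x, x ∂ν = 0) (hsq : Integrable (fun x => x ^ 2) ν) (hvar : 0 < ∫ x, x ^ 2 ∂ν) :
    ∃ C : ℝ, ∀ (ρ : Measure ℝ) [IsProbabilityMeasure ρ] (k : ℕ),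
      (∀ t, charFun ρ t = charFun ν t ^ (k + 1)) →
      ∫ x, Real.exp (-|x|) ∂ρ ≤ C * ((k : ℝ) + 1) ^ (-(1 : ℝ) / 2) := by
  obtain ⟨c, δ, hc, hδ, hδ1, hexp⟩ := exists_norm_charFun_le_exp hmean hsq hvar
  refine ⟨4 / δ * √(Real.pi / c) * (2 * ∑' m : ℕ, Real.exp (-m)), fun ρ _ k hk => ?_⟩
  have hQ : ∀ y : ℝ, ρ.real (Icc (y - 1) (y + 1))
      ≤ 4 / δ * (√(Real.pi / c) * ((k : ℝ) + 1) ^ (-(1 : ℝ) / 2)) := by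
    intro y
    refine (measureReal_Icc_le_integral_norm_charFun hδ hδ1 y).trans ?_
    refine mul_le_mul_of_nonneg_left ?_ (by positivity)
    have e : √(Real.pi / c) * ((k : ℝ) + 1) ^ (-(1 : ℝ) / 2) = √(Real.pi / (c * (k + 1))) := by
      rw [← div_div, Real.sqrt_div (by positivity) ((k : ℝ) + 1), div_eq_mul_inv _ √((k : ℝ) + 1),
        neg_div, Real.rpow_neg (by positivity), Real.sqrt_eq_rpow ((k : ℝ) + 1)]
    rw [e]
    refine le_trans ?_ (integral_exp_neg_mul_sq_le (by positivity) hδ)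
    refine intervalIntegral.integral_mono_on hδ.le
      (continuous_charFun.norm.intervalIntegrable _ _)
      (Continuous.intervalIntegrable (by fun_prop) _ _) fun t ht => ?_
    rw [hk, norm_pow]
    refine (pow_le_pow_left₀ (norm_nonneg _) (hexp t ht.1 ht.2) _).trans (le_of_eq ?_)
    rw [← Real.exp_nat_mul]
    congr 1
    push_cast
    ring
  refine (integral_exp_neg_abs_le hQ).trans (le_of_eq ?_)
  ring

lemma powerSeries_wienerHopf {R : Type*} [CommRing R] {U V P Q : ℕ → R} {z : R}
    (hU0 : U 0 = 1) (hV0 : V 0 = 1)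
    (hUV : ∀ n, z ^ n = ∑ q ∈ Finset.HasAntidiagonal.antidiagonal n, V q.1 * U q.2)
    (hPQ : ∀ k, P k + Q k = z ^ (k + 1)) (n : ℕ)
    (hU : ∀ m < n, ((m : R) + 1) * U (m + 1) =
      ∑ q ∈ Finset.HasAntidiagonal.antidiagonal m, P q.1 * U q.2)
    (hV : ∀ m < n, ((m : R) + 1) * V (m + 1) =
      ∑ q ∈ Finset.HasAntidiagonal.antidiagonal m, Q q.1 * V q.2) :
    ((n : R) + 1) * U (n + 1) + ((n : R) + 1) * V (n + 1)
      = ∑ q ∈ Finset.HasAntidiagonal.antidiagonal n, P q.1 * U q.2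
        + ∑ q ∈ Finset.HasAntidiagonal.antidiagonal n, Q q.1 * V q.2 := by
  set u := PowerSeries.mk U
  set v := PowerSeries.mk V
  set p := PowerSeries.mk P
  set r := PowerSeries.mk Q
  set e := PowerSeries.derivative R u - p * u with he
  set f := PowerSeries.derivative R v - r * v with hf
  have hec : ∀ m, PowerSeries.coeff m e
      = ((m : R) + 1) * U (m + 1) - ∑ q ∈ Finset.HasAntidiagonal.antidiagonal m, P q.1 * U q.2 :=
    fun m => by
    simp only [he, u, p, map_sub, PowerSeries.coeff_mul, PowerSeries.coeff_derivative,
      PowerSeries.coeff_mk]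
    ring
  have hfc : ∀ m, PowerSeries.coeff m f
      = ((m : R) + 1) * V (m + 1) - ∑ q ∈ Finset.HasAntidiagonal.antidiagonal m, Q q.1 * V q.2 :=
    fun m => by
    simp only [hf, v, r, map_sub, PowerSeries.coeff_mul, PowerSeries.coeff_derivative,
      PowerSeries.coeff_mk]
    ring
  have hvu : v * u = PowerSeries.mk fun n => z ^ n := by
    ext m
    simp [u, v, PowerSeries.coeff_mul, hUV]
  have hpr : p + r = PowerSeries.mk fun n => z ^ (n + 1) := by
    ext m
    simp [p, r, hPQ]
  have hd : PowerSeries.derivative R (v * u) = (p + r) * (v * u) := by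
    rw [hvu, hpr]
    ext m
    rw [PowerSeries.coeff_derivative, PowerSeries.coeff_mul, PowerSeries.coeff_mk,
      Finset.sum_congr rfl (g := fun _ => z ^ (m + 1)) fun q hq => ?_]
    · simp [mul_comm]
    · rw [PowerSeries.coeff_mk, PowerSeries.coeff_mk, ← pow_add,
        ← Finset.HasAntidiagonal.mem_antidiagonal.1 hq]
      congr 1
      omega
  have hzero : e * v + f * u = 0 := by
    rw [Derivation.leibniz, smul_eq_mul, smul_eq_mul] at hd
    rw [he, hf]
    linear_combination hd
  have hcoeff : ∀ (g h : PowerSeries R), (∀ m < n, PowerSeries.coeff m g = 0) →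
      PowerSeries.coeff 0 h = 1 → PowerSeries.coeff n (g * h) = PowerSeries.coeff n g := by
    intro g h hg hh
    rw [PowerSeries.coeff_mul, Finset.sum_eq_single (n, 0), hh, mul_one]
    · rintro ⟨i, j⟩ hij hne
      have hij' := Finset.HasAntidiagonal.mem_antidiagonal.1 hij
      simp only at hij'
      have : i < n := by
        refine lt_of_le_of_ne (by omega) fun h => hne ?_
        rw [Prod.mk.injEq]
        omega
      rw [hg i this, zero_mul]
    · simp
  have h := congrArg (PowerSeries.coeff n) hzero
  rw [map_add, hcoeff e v (fun m hm => by rw [hec, hU m hm, sub_self])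
      (by rw [PowerSeries.coeff_mk, hV0]),
    hcoeff f u (fun m hm => by rw [hfc, hV m hm, sub_self])
      (by rw [PowerSeries.coeff_mk, hU0]), hec, hfc, map_zero] at h
  linear_combination h

lemma measure_add_eq_add {A B C D : Measure ℝ} {s : Set ℝ}
    (hA : A sᶜ = 0) (hB : B s = 0) (hC : C sᶜ = 0) (hD : D s = 0) (h : A + B = C + D) :
    A = C ∧ B = D := by
  have key : ∀ {M M' : Measure ℝ} {r : Set ℝ}, M rᶜ = 0 → M' r = 0 → (M + M').restrict r = M :=
    fun {M M' r} hM hM' => by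
      rw [Measure.restrict_add, Measure.restrict_eq_zero.2 hM', add_zero]
      exact Measure.restrict_eq_self_of_ae_mem hM
  refine ⟨by rw [← key hA hB, h, key hC hD], ?_⟩
  rw [← key (M := B) (M' := A) (r := sᶜ) (by rwa [compl_compl]) hA, add_comm, h, add_comm,
    key (by rwa [compl_compl]) hC]

lemma isFiniteMeasure_finsetSum {ι : Type*} (s : Finset ι) (m : ι → Measure ℝ)
    [∀ i, IsFiniteMeasure (m i)] : IsFiniteMeasure (∑ i ∈ s, m i) := by
  refine ⟨?_⟩
  rw [Measure.finsetSum_apply]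
  exact ENNReal.sum_lt_top.2 fun i _ => measure_lt_top _ _

lemma integrable_charFun_integrand (m : Measure ℝ) [IsFiniteMeasure m] (t : ℝ) :
    Integrable (fun x : ℝ => Complex.exp (t * x * Complex.I)) m := by
  refine (integrable_const (1 : ℝ)).mono' (by fun_prop) (ae_of_all _ fun x => ?_)
  rw [← Complex.ofReal_mul, Complex.norm_exp_ofReal_mul_I]

lemma charFun_add_measure (m m' : Measure ℝ) [IsFiniteMeasure m] [IsFiniteMeasure m'] (t : ℝ) :
    charFun (m + m') t = charFun m t + charFun m' t := by
  simp_rw [charFun_apply_real]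
  exact integral_add_measure (integrable_charFun_integrand _ _) (integrable_charFun_integrand _ _)

lemma charFun_finsetSum_measure {ι : Type*} (s : Finset ι) (m : ι → Measure ℝ)
    [∀ i, IsFiniteMeasure (m i)] (t : ℝ) :
    charFun (∑ i ∈ s, m i) t = ∑ i ∈ s, charFun (m i) t := by
  simp_rw [charFun_apply_real]
  exact integral_finsetSum_measure fun i _ => integrable_charFun_integrand _ _

lemma charFun_nnreal_smul_measure (c : NNReal) (m : Measure ℝ) (t : ℝ) :
    charFun (c • m) t = (c : ℂ) * charFun m t := by
  simp_rw [charFun_apply_real]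
  rw [integral_smul_nnreal_measure]
  rfl

lemma ae_conv_of_ae {m m' : Measure ℝ} [SFinite m] [SFinite m'] {p q r : ℝ → Prop}
    (hr : MeasurableSet {x | r x}) (hp : ∀ᵐ x ∂m, p x) (hq : ∀ᵐ x ∂m', q x)
    (h : ∀ x y, p x → q y → r (x + y)) : ∀ᵐ x ∂(m ∗ m'), r x := by
  rw [Measure.conv, ae_map_iff (by fun_prop) hr]
  have h1 := Measure.quasiMeasurePreserving_fst (μ := m) (ν := m') |>.ae hp
  have h2 := Measure.quasiMeasurePreserving_snd (μ := m) (ν := m') |>.ae hq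
  filter_upwards [h1, h2] with z hz1 hz2 using h _ _ hz1 hz2

lemma finsetSum_measure_eq_zero {ι : Type*} {s : Finset ι} {m : ι → Measure ℝ} {A : Set ℝ}
    (h : ∀ i ∈ s, m i A = 0) : (∑ i ∈ s, m i) A = 0 := by
  rw [Measure.finsetSum_apply]
  exact Finset.sum_eq_zero h

/-- **Spitzer's identity** in recursive form: the positive and the negative Wiener-Hopf factors
`u`, `v` of the convolution powers `F` are determined by the restrictions of `F` to the
half-lines. -/
theorem spitzer_identity {u v F : ℕ → Measure ℝ} [∀ n, IsFiniteMeasure (u n)]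
    [∀ n, IsFiniteMeasure (v n)] [∀ n, IsFiniteMeasure (F n)] {φ : ℝ → ℂ}
    (hu0 : u 0 = Measure.dirac 0) (hv0 : v 0 = Measure.dirac 0)
    (hu : ∀ n, ∀ᵐ x ∂(u n), 0 ≤ x) (hv : ∀ n, ∀ᵐ x ∂(v (n + 1)), x < 0)
    (hF : ∀ n t, charFun (F n) t = φ t ^ n)
    (hfact : ∀ n, F n = ∑ q ∈ Finset.HasAntidiagonal.antidiagonal n, v q.1 ∗ u q.2) (n : ℕ) :
    ((n : NNReal) + 1) • u (n + 1)
        = ∑ q ∈ Finset.HasAntidiagonal.antidiagonal n, (F (q.1 + 1)).restrict (Ici 0) ∗ u q.2 ∧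
      ((n : NNReal) + 1) • v (n + 1)
        = ∑ q ∈ Finset.HasAntidiagonal.antidiagonal n, (F (q.1 + 1)).restrict (Iio 0) ∗ v q.2 := by
  have hv' : ∀ n, ∀ᵐ x ∂(v n), x ≤ 0 := by
    rintro (_ | n)
    · rw [hv0, ae_dirac_iff measurableSet_Iic]
    · filter_upwards [hv n] with x hx using hx.le
  induction n using Nat.strong_induction_on with
  | _ n ih =>
  have hcompl : (Ici (0 : ℝ))ᶜ = Iio 0 := compl_Ici
  refine measure_add_eq_add (s := Ici 0) ?_ ?_ ?_ ?_ ?_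
  · rw [Measure.smul_apply, hcompl]
    have : u (n + 1) (Iio 0) = 0 := by simpa [ae_iff, Iio_def] using hu (n + 1)
    rw [this, smul_zero]
  · rw [Measure.smul_apply]
    have : v (n + 1) (Ici 0) = 0 := by simpa [ae_iff, Ici_def] using hv n
    rw [this, smul_zero]
  · refine finsetSum_measure_eq_zero fun q _ => ?_
    have := ae_conv_of_ae (r := fun x => 0 ≤ x) measurableSet_Ici
      (ae_restrict_mem (μ := F (q.1 + 1)) (measurableSet_Ici (a := 0))) (hu q.2)
      fun x y hx hy => add_nonneg hx hy
    rw [hcompl]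
    simpa [ae_iff, Iio_def] using this
  · refine finsetSum_measure_eq_zero fun q _ => ?_
    have := ae_conv_of_ae (r := fun x => x < 0) measurableSet_Iio
      (ae_restrict_mem (μ := F (q.1 + 1)) (measurableSet_Iio (a := 0))) (hv' q.2)
      fun x y hx hy => add_neg_of_neg_of_nonpos hx hy
    simpa [ae_iff, Ici_def] using this
  · have := isFiniteMeasure_finsetSum (Finset.HasAntidiagonal.antidiagonal n)
      fun q => (F (q.1 + 1)).restrict (Ici 0) ∗ u q.2
    have := isFiniteMeasure_finsetSum (Finset.HasAntidiagonal.antidiagonal n)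
      fun q => (F (q.1 + 1)).restrict (Iio 0) ∗ v q.2
    refine Measure.ext_of_charFun (funext fun t => ?_)
    rw [charFun_add_measure, charFun_add_measure, charFun_nnreal_smul_measure,
      charFun_nnreal_smul_measure, charFun_finsetSum_measure, charFun_finsetSum_measure]
    simp_rw [charFun_conv]
    have hcast : ∀ m : ℕ, (((m : NNReal) + 1 : NNReal) : ℂ) = (m : ℂ) + 1 := fun m => by
      push_cast; rfl
    rw [hcast]
    refine powerSeries_wienerHopf (z := φ t) (U := fun k => charFun (u k) t)
      (V := fun k => charFun (v k) t)
      (P := fun k => charFun ((F (k + 1)).restrict (Ici 0)) t)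
      (Q := fun k => charFun ((F (k + 1)).restrict (Iio 0)) t) ?_ ?_ ?_ ?_ n ?_ ?_
    · simp [hu0, charFun_dirac]
    · simp [hv0, charFun_dirac]
    · intro k
      rw [← hF, hfact, charFun_finsetSum_measure]
      simp_rw [charFun_conv]
    · intro k
      rw [← charFun_add_measure, ← hcompl, Measure.restrict_add_restrict_compl measurableSet_Ici,
        hF]
    · intro m hm
      have := congrArg (fun M => charFun M t) (ih m hm).1
      simp only [charFun_nnreal_smul_measure, charFun_finsetSum_measure, charFun_conv, hcast]
        at this
      exact this
    · intro m hm
      have := congrArg (fun M => charFun M t) (ih m hm).2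
      simp only [charFun_nnreal_smul_measure, charFun_finsetSum_measure, charFun_conv, hcast]
        at this
      exact this

lemma integrable_exp_mul_of_ae_nonpos {m : Measure ℝ} [IsFiniteMeasure m] {θ : ℝ}
    (h : ∀ᵐ x ∂m, θ * x ≤ 0) : Integrable (fun x => Real.exp (θ * x)) m := by
  refine (integrable_const (1 : ℝ)).mono' (by fun_prop) ?_
  filter_upwards [h] with x hx
  rw [Real.norm_of_nonneg (Real.exp_pos _).le]
  exact Real.exp_le_one_iff.2 hx

/-- Laplace transforms turn a sum of convolutions into a sum of products. -/
lemma integral_exp_of_smul_eq_sum_conv {ι : Type*} {s : Finset ι} {m : Measure ℝ}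
    {p r : ι → Measure ℝ} [∀ i, IsFiniteMeasure (p i)] [∀ i, IsFiniteMeasure (r i)] {θ : ℝ}
    {c : NNReal} (h : c • m = ∑ i ∈ s, p i ∗ r i) (hp : ∀ i, ∀ᵐ x ∂(p i), θ * x ≤ 0)
    (hr : ∀ i, ∀ᵐ x ∂(r i), θ * x ≤ 0) :
    c * ∫ x, Real.exp (θ * x) ∂m
      = ∑ i ∈ s, (∫ x, Real.exp (θ * x) ∂(p i)) * ∫ x, Real.exp (θ * x) ∂(r i) := by
  have hconv : ∀ i, Integrable (fun x => Real.exp (θ * x)) (p i ∗ r i) := fun i =>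
    integrable_exp_mul_of_ae_nonpos <|
      ae_conv_of_ae (measurableSet_le (by fun_prop) (by fun_prop)) (hp i) (hr i)
        fun x y hx hy => by rw [mul_add]; exact add_nonpos hx hy
  have h1 := congrArg (fun M => ∫ x, Real.exp (θ * x) ∂M) h
  rw [integral_smul_nnreal_measure, integral_finsetSum_measure fun i _ => hconv i] at h1
  refine h1.trans (Finset.sum_congr rfl fun i _ => ?_)
  rw [integral_conv (hconv i)]
  simp_rw [mul_add, Real.exp_add, integral_const_mul, integral_mul_const]

lemma minWalk_le {α : Type*} (X : ℕ → α → ℝ) {i n : ℕ} (hi : i ≤ n) (ω : α) :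
    minWalk X n ω ≤ walk X i ω :=
  Finset.inf'_le (f := fun i => walk X i ω) (Finset.mem_range.2 (Nat.lt_succ_of_le hi))

lemma exists_walk_eq_minWalk {α : Type*} (X : ℕ → α → ℝ) (n : ℕ) (ω : α) :
    ∃ i ≤ n, walk X i ω = minWalk X n ω := by
  obtain ⟨i, hi, h⟩ := Finset.exists_mem_eq_inf' (s := Finset.range (n + 1)) (by simp)
    fun i => walk X i ω
  exact ⟨i, Nat.le_of_lt_succ (Finset.mem_range.1 hi), h.symm⟩

lemma tauWalk_le {α : Type*} (X : ℕ → α → ℝ) (n : ℕ) (ω : α) : tauWalk X n ω ≤ n := by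
  obtain ⟨i, hi, h⟩ := exists_walk_eq_minWalk X n ω
  exact (Nat.sInf_le h).trans hi

lemma walk_tauWalk {α : Type*} (X : ℕ → α → ℝ) (n : ℕ) (ω : α) :
    walk X (tauWalk X n ω) ω = minWalk X n ω := by
  obtain ⟨i, -, h⟩ := exists_walk_eq_minWalk X n ω
  exact Nat.sInf_mem (s := {i | walk X i ω = minWalk X n ω}) ⟨i, h⟩

lemma tauWalk_eq_iff {α : Type*} (X : ℕ → α → ℝ) {j n : ℕ} (hj : j ≤ n) (ω : α) :
    tauWalk X n ω = j ↔ (∀ i < j, walk X j ω < walk X i ω) ∧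
      ∀ i, j ≤ i → i ≤ n → walk X j ω ≤ walk X i ω := by
  constructor
  · rintro rfl
    rw [walk_tauWalk]
    refine ⟨fun i hi => lt_of_le_of_ne (minWalk_le X (hi.le.trans hj) ω) fun h => ?_,
      fun i _ hi => minWalk_le X hi ω⟩
    exact Nat.notMem_of_lt_sInf hi h.symm
  · rintro ⟨h1, h2⟩
    have hmin : walk X j ω = minWalk X n ω := by
      refine le_antisymm (Finset.le_inf' _ _ fun i hi => ?_) (minWalk_le X hj ω)
      rcases lt_or_ge i j with hij | hij
      · exact (h1 i hij).le
      · exact h2 i hij (Nat.le_of_lt_succ (Finset.mem_range.1 hi))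
    refine le_antisymm (Nat.sInf_le hmin) (not_lt.1 fun hlt => ?_)
    have := h1 _ hlt
    rw [walk_tauWalk, hmin] at this
    exact lt_irrefl _ this

@[fun_prop]
lemma measurable_walk {X : ℕ → Ω → ℝ} (hX : ∀ i, Measurable (X i)) (n : ℕ) :
    Measurable (walk X n) := by
  unfold walk
  fun_prop

lemma measurableSet_tauWalk_eq {X : ℕ → Ω → ℝ} (hX : ∀ i, Measurable (X i)) {j n : ℕ}
    (hj : j ≤ n) : MeasurableSet {ω | tauWalk X n ω = j} := by
  have := measurable_walk hX
  simp_rw [tauWalk_eq_iff X hj]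
  refine MeasurableSet.inter (s₁ := {ω | ∀ i < j, walk X j ω < walk X i ω}) ?_ ?_
  · simp_rw [ofPred_forall]
    exact .iInter fun i => .iInter fun _ => measurableSet_lt (this j) (this i)
  · change MeasurableSet {ω | ∀ i, j ≤ i → i ≤ n → walk X j ω ≤ walk X i ω}
    simp_rw [ofPred_forall]
    exact .iInter fun i => .iInter fun _ => .iInter fun _ => measurableSet_le (this j) (this i)

lemma measurableSet_posSet {X : ℕ → Ω → ℝ} (hX : ∀ i, Measurable (X i)) (x : ℝ) (n : ℕ) :
    MeasurableSet (posSet X x n) := by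
  have := measurable_walk hX
  simp_rw [posSet, ofPred_forall]
  exact .iInter fun i => .iInter fun _ => measurableSet_le measurable_const (by fun_prop)

/-- Keep the coordinates with indices `1, ..., m` of a sequence, and erase all the others. -/
def trunc (m : ℕ) (x : ℕ → ℝ) : ℕ → ℝ := fun i => if i ∈ Finset.Icc 1 m then x i else 0

lemma measurable_trunc (m : ℕ) : Measurable (trunc m) := by
  refine measurable_pi_lambda _ fun i => ?_
  unfold trunc
  split_ifs <;> fun_prop

/-- The coordinate process on the space of real sequences. -/
def coord (i : ℕ) (x : ℕ → ℝ) : ℝ := x i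

lemma measurable_coord (i : ℕ) : Measurable (coord i) := measurable_pi_apply i

lemma walk_coord_trunc {k m : ℕ} (h : k ≤ m) (x : ℕ → ℝ) :
    walk coord k (trunc m x) = walk coord k x := by
  refine Finset.sum_congr rfl fun i hi => ?_
  rw [Finset.mem_Icc] at hi
  exact if_pos (Finset.mem_Icc.2 ⟨hi.1, hi.2.trans h⟩)

lemma walk_add {α : Type*} (X : ℕ → α → ℝ) (j k : ℕ) (ω : α) :
    walk X (j + k) ω = walk X j ω + walk coord k fun i => X (j + i) ω := by
  induction k with
  | zero => simp [walk]
  | succ k ih =>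
    have h : ∀ (Y : ℕ → (ℕ → ℝ) → ℝ) (y : ℕ → ℝ) (n : ℕ),
        walk Y (n + 1) y = walk Y n y + Y (n + 1) y := fun Y y n =>
      Finset.sum_Icc_succ_top (by omega) _
    rw [← add_assoc, walk, Finset.sum_Icc_succ_top (by omega), ← walk, ih, h, add_assoc]
    rfl

lemma tauWalk_add_eq_iff {α : Type*} (X : ℕ → α → ℝ) (j m : ℕ) (ω : α) :
    tauWalk X (j + m) ω = j ↔
      tauWalk X j ω = j ∧ (fun i => X (j + i) ω) ∈ posSet coord 0 m := by
  rw [tauWalk_eq_iff X (Nat.le_add_right j m), tauWalk_eq_iff X le_rfl]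
  have h1 : ∀ i, j ≤ i → i ≤ j → walk X j ω ≤ walk X i ω := fun i h h' => by
    rw [le_antisymm h h']
  rw [and_iff_left h1]
  simp only [posSet, mem_ofPred_eq, zero_add, Finset.mem_Icc]
  refine and_congr_right fun _ => ⟨fun h i hi => ?_, fun h i hi hi' => ?_⟩
  · have := h (j + i) (by omega) (by omega)
    rw [walk_add] at this
    linarith
  · obtain ⟨k, rfl⟩ := Nat.exists_eq_add_of_le hi
    rw [walk_add]
    rcases Nat.eq_zero_or_pos k with rfl | hk
    · simp [walk]
    · linarith [h k ⟨hk, by omega⟩]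

lemma tauWalk_coord_trunc (j : ℕ) (x : ℕ → ℝ) :
    tauWalk coord j (trunc j x) = j ↔ tauWalk coord j x = j := by
  rw [tauWalk_eq_iff coord le_rfl, tauWalk_eq_iff coord le_rfl]
  simp +contextual only [walk_coord_trunc, le_refl, le_of_lt]

lemma trunc_mem_posSet_coord (m : ℕ) (x : ℕ → ℝ) :
    trunc m x ∈ posSet coord 0 m ↔ x ∈ posSet coord 0 m := by
  simp +contextual only [posSet, mem_ofPred_eq, Finset.mem_Icc, walk_coord_trunc]

section IID

variable {μ : Measure Ω} {X : ℕ → Ω → ℝ}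

lemma indepFun_trunc (hX : ∀ i, Measurable (X i)) (hind : iIndepFun X μ) (j m : ℕ) :
    IndepFun (fun ω => trunc j fun i => X i ω) (fun ω => trunc m fun i => X (j + i) ω) μ := by
  classical
  have hdisj : Disjoint (Finset.Icc 1 j) (Finset.Icc (j + 1) (j + m)) := by
    rw [Finset.disjoint_left]
    intro i
    simp only [Finset.mem_Icc]
    omega
  let extend (s : Finset ℕ) (j : ℕ) (y : s → ℝ) : ℕ → ℝ := fun i =>
    if h : j + i ∈ s then y ⟨j + i, h⟩ else 0
  have hextend : ∀ s j, Measurable (extend s j) := fun s j => by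
    refine measurable_pi_lambda _ fun i => ?_
    by_cases h : j + i ∈ s
    · simp only [extend, h, dite_true]
      fun_prop
    · simp only [extend, h, dite_false]
      fun_prop
  have h := (hind.indepFun_finset _ _ hdisj hX).comp (hextend _ 0) (hextend _ j)
  convert h using 1
  · funext ω i
    simp [trunc, extend]
  · funext ω i
    simp only [trunc, extend, Function.comp, Finset.mem_Icc, dite_eq_ite]
    congr 1
    rw [eq_iff_iff]
    omega

lemma map_trunc_shift (hiid : IIDseq μ X) (j m : ℕ) :
    μ.map (fun ω => trunc m fun i => X (j + i) ω) = μ.map fun ω => trunc m fun i => X i ω := by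
  have h : IdentDistrib (fun ω i => X (j + i) ω) (fun ω i => X i ω) μ μ :=
    IdentDistrib.pi (fun i => (hiid.2.2 (j + i)).trans (hiid.2.2 i).symm)
      (hiid.2.1.precomp (add_right_injective j)) hiid.2.1
  exact (h.comp (measurable_trunc m)).map_eq

/-- Splitting the walk at its first minimum: the two pieces are independent. -/
theorem map_restrict_tauWalk_eq_prod [IsProbabilityMeasure μ] (hiid : IIDseq μ X) (j m : ℕ) :
    (μ.restrict {ω | tauWalk X (j + m) ω = j}).map
        (fun ω => (walk X j ω, walk X (j + m) ω - walk X j ω))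
      = ((μ.restrict {ω | tauWalk X j ω = j}).map (walk X j)).prod
          ((μ.restrict (posSet X 0 m)).map (walk X m)) := by
  have hX := hiid.1
  set ξ : Ω → ℕ → ℝ := fun ω => trunc j fun i => X i ω
  set η : Ω → ℕ → ℝ := fun ω => trunc m fun i => X (j + i) ω
  set η' : Ω → ℕ → ℝ := fun ω => trunc m fun i => X i ω
  have hξ : Measurable ξ := (measurable_trunc j).comp (by fun_prop)
  have hη : Measurable η := (measurable_trunc m).comp (by fun_prop)
  have hη' : Measurable η' := (measurable_trunc m).comp (by fun_prop)
  set A : Set (ℕ → ℝ) := {x | tauWalk coord j x = j}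
  set B : Set (ℕ → ℝ) := posSet coord 0 m
  have hA : MeasurableSet A := measurableSet_tauWalk_eq measurable_coord le_rfl
  have hB : MeasurableSet B := measurableSet_posSet measurable_coord 0 m
  have hf := measurable_walk measurable_coord j
  have hg := measurable_walk measurable_coord m
  have hpre : {ω | tauWalk X (j + m) ω = j} = (fun ω => (ξ ω, η ω)) ⁻¹' (A ×ˢ B) := by
    ext ω
    rw [mem_ofPred_eq, tauWalk_add_eq_iff]
    exact and_congr (tauWalk_coord_trunc j _).symm (trunc_mem_posSet_coord m _).symm
  have hpreA : {ω | tauWalk X j ω = j} = ξ ⁻¹' A := by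
    ext ω
    exact (tauWalk_coord_trunc j _).symm
  have hpreB : posSet X 0 m = η' ⁻¹' B := by
    ext ω
    exact (trunc_mem_posSet_coord m _).symm
  have hfun : (fun ω => (walk X j ω, walk X (j + m) ω - walk X j ω))
      = Prod.map (walk coord j) (walk coord m) ∘ fun ω => (ξ ω, η ω) := by
    funext ω
    simp only [Function.comp, Prod.map, ξ, η]
    rw [walk_coord_trunc le_rfl, walk_coord_trunc le_rfl, walk_add, add_sub_cancel_left]
    rfl
  have hfunA : walk X j = walk coord j ∘ ξ := by
    funext ω
    exact (walk_coord_trunc le_rfl _).symm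
  have hfunB : walk X m = walk coord m ∘ η' := by
    funext ω
    exact (walk_coord_trunc le_rfl _).symm
  rw [hfun, hpre, ← Measure.map_map (hf.prodMap hg) (hξ.prodMk hη),
    ← Measure.restrict_map (hξ.prodMk hη) (hA.prod hB),
    (indepFun_iff_map_prod_eq_prod_map_map hξ.aemeasurable hη.aemeasurable).1
      (indepFun_trunc hX hiid.2.1 j m), map_trunc_shift hiid j m, ← Measure.prod_restrict,
    ← Measure.map_prod_map _ _ hf hg, Measure.restrict_map hξ hA, Measure.restrict_map hη' hB,
    Measure.map_map hf hξ, Measure.map_map hg hη', ← hfunA, ← hfunB, ← hpreA, ← hpreB]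

/-- The law of `S j` on the event that the walk has a strict minimum at its end point `j`. -/
def minLaw (μ : Measure Ω) (X : ℕ → Ω → ℝ) (j : ℕ) : Measure ℝ :=
  (μ.restrict {ω | tauWalk X j ω = j}).map (walk X j)

/-- The law of `S m` on the event that the walk stays nonnegative up to time `m`. -/
def posLaw (μ : Measure Ω) (X : ℕ → Ω → ℝ) (m : ℕ) : Measure ℝ :=
  (μ.restrict (posSet X 0 m)).map (walk X m)

instance [IsFiniteMeasure μ] (j : ℕ) : IsFiniteMeasure (minLaw μ X j) := by
  unfold minLaw
  infer_instance

instance [IsFiniteMeasure μ] (m : ℕ) : IsFiniteMeasure (posLaw μ X m) := by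
  unfold posLaw
  infer_instance

lemma integral_minLaw (hX : ∀ i, Measurable (X i)) (j : ℕ) {f : ℝ → ℝ} (hf : Measurable f) :
    ∫ x, f x ∂(minLaw μ X j) = ∫ ω in {ω | tauWalk X j ω = j}, f (walk X j ω) ∂μ :=
  integral_map (measurable_walk hX j).aemeasurable hf.aestronglyMeasurable

lemma integral_posLaw (hX : ∀ i, Measurable (X i)) (m : ℕ) {f : ℝ → ℝ} (hf : Measurable f) :
    ∫ x, f x ∂(posLaw μ X m) = ∫ ω in posSet X 0 m, f (walk X m ω) ∂μ :=
  integral_map (measurable_walk hX m).aemeasurable hf.aestronglyMeasurable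

theorem setIntegral_tauWalk_eq_mul [IsProbabilityMeasure μ] (hiid : IIDseq μ X)
    {j n : ℕ} (hj : j ≤ n) :
    ∫ ω in {ω | tauWalk X n ω = j}, Real.exp (2 * walk X j ω - walk X n ω) ∂μ
      = (∫ ω in {ω | tauWalk X j ω = j}, Real.exp (walk X j ω) ∂μ) *
        ∫ ω in posSet X 0 (n - j), Real.exp (-walk X (n - j) ω) ∂μ := by
  obtain ⟨m, rfl⟩ := Nat.exists_eq_add_of_le hj
  have hX := hiid.1
  have hw := measurable_walk hX
  rw [Nat.add_sub_cancel_left, ← integral_minLaw hX j Real.measurable_exp,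
    ← integral_posLaw hX m (f := fun x => Real.exp (-x)) (by fun_prop), ← integral_prod_mul,
    minLaw, posLaw, ← map_restrict_tauWalk_eq_prod hiid, integral_map (by fun_prop) (by fun_prop)]
  refine integral_congr_ae (ae_of_all _ fun ω => ?_)
  simp only [← Real.exp_add]
  congr 1
  ring

lemma minLaw_zero [IsProbabilityMeasure μ] : minLaw μ X 0 = Measure.dirac 0 := by
  have h : {ω | tauWalk X 0 ω = 0} = univ :=
    eq_univ_of_forall fun ω => Nat.le_zero.1 (tauWalk_le X 0 ω)
  have hw : walk X 0 = fun _ => 0 := by funext; simp [walk]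
  rw [minLaw, h, hw, Measure.restrict_univ, Measure.map_const, measure_univ, one_smul]

lemma posLaw_zero [IsProbabilityMeasure μ] : posLaw μ X 0 = Measure.dirac 0 := by
  have h : posSet X 0 0 = univ := by simp [posSet]
  have hw : walk X 0 = fun _ => 0 := by funext; simp [walk]
  rw [posLaw, h, hw, Measure.restrict_univ, Measure.map_const, measure_univ, one_smul]

lemma ae_minLaw_neg (hX : ∀ i, Measurable (X i)) (j : ℕ) : ∀ᵐ x ∂(minLaw μ X (j + 1)), x < 0 := by
  rw [minLaw, ae_map_iff (measurable_walk hX _).aemeasurable measurableSet_Iio]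
  filter_upwards [ae_restrict_mem (measurableSet_tauWalk_eq hX le_rfl)] with ω hω
  have := ((tauWalk_eq_iff X le_rfl ω).1 hω).1 0 (by omega)
  simpa [walk] using this

lemma ae_posLaw_nonneg (hX : ∀ i, Measurable (X i)) (m : ℕ) : ∀ᵐ x ∂(posLaw μ X m), 0 ≤ x := by
  rw [posLaw, ae_map_iff (measurable_walk hX _).aemeasurable measurableSet_Ici]
  filter_upwards [ae_restrict_mem (measurableSet_posSet hX 0 m)] with ω hω
  rcases Nat.eq_zero_or_pos m with rfl | hm
  · simp [walk]
  · simpa using hω m (Finset.mem_Icc.2 ⟨hm, le_rfl⟩)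

lemma charFun_map_walk [IsProbabilityMeasure μ] (hiid : IIDseq μ X) (n : ℕ) (t : ℝ) :
    charFun (μ.map (walk X n)) t = charFun (μ.map (X 1)) t ^ n := by
  have h := iIndepFun.charFun_map_fun_finsetSum_eq_prod (s := Finset.Icc 1 n)
    (fun i _ => (hiid.1 i).aemeasurable) (hiid.2.1.precomp (g := Subtype.val) Subtype.val_injective)
  have hw : walk X n = fun ω => ∑ i ∈ Finset.Icc 1 n, X i ω := rfl
  rw [hw, h, Finset.prod_apply, Finset.prod_congr rfl fun i _ => by rw [(hiid.2.2 i).map_eq]]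
  simp

/-- The Wiener-Hopf factorization of the law of the walk. -/
theorem map_walk_eq_sum_conv [IsProbabilityMeasure μ] (hiid : IIDseq μ X) (n : ℕ) :
    μ.map (walk X n)
      = ∑ q ∈ Finset.HasAntidiagonal.antidiagonal n, minLaw μ X q.1 ∗ posLaw μ X q.2 := by
  have hX := hiid.1
  have hw := measurable_walk hX
  have hpiece : ∀ q ∈ Finset.HasAntidiagonal.antidiagonal n, minLaw μ X q.1 ∗ posLaw μ X q.2
      = (μ.restrict {ω | tauWalk X n ω = q.1}).map (walk X n) := by
    intro q hq
    rw [Finset.HasAntidiagonal.mem_antidiagonal] at hq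
    rw [Measure.conv, minLaw, posLaw, ← map_restrict_tauWalk_eq_prod hiid, hq,
      Measure.map_map (by fun_prop) (by fun_prop)]
    congr 1
    funext ω
    simp
  rw [Finset.sum_congr rfl hpiece, Finset.Nat.sum_antidiagonal_eq_sum_range_succ_mk]
  ext s hs
  rw [Measure.finsetSum_apply, Measure.map_apply (hw n) hs]
  have hcover : walk X n ⁻¹' s
      = ⋃ j ∈ Finset.range (n + 1), walk X n ⁻¹' s ∩ {ω | tauWalk X n ω = j} := by
    ext ω
    simpa using fun _ => tauWalk_le X n ω
  have hmeas : ∀ j ∈ Finset.range (n + 1), MeasurableSet {ω | tauWalk X n ω = j} := fun j hj =>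
    measurableSet_tauWalk_eq hX (Nat.le_of_lt_succ (Finset.mem_range.1 hj))
  conv_lhs => rw [hcover]
  rw [measure_biUnion_finset]
  · refine Finset.sum_congr rfl fun j hj => ?_
    rw [Measure.map_apply (hw n) hs, Measure.restrict_apply (hw n hs)]
  · intro i _ j _ hij
    refine Set.disjoint_left.2 fun ω h h' => hij ?_
    rw [← h.2, ← h'.2]
  · exact fun j hj => (hw n hs).inter (hmeas j hj)

/-- The Laplace transforms of the two Wiener-Hopf factors decay at rate `n ^ (-3/2)`. -/
theorem exists_integral_exp_factors_le [IsProbabilityMeasure μ] (hiid : IIDseq μ X)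
    (hmean : ∫ ω, X 1 ω ∂μ = 0) (hsq : Integrable (fun ω => X 1 ω ^ 2) μ)
    (hvar : 0 < ∫ ω, X 1 ω ^ 2 ∂μ) :
    ∃ D, 0 ≤ D ∧ ∀ n : ℕ,
      ∫ x, Real.exp x ∂(minLaw μ X (n + 1)) ≤ D * ((n : ℝ) + 1) ^ (-(3 : ℝ) / 2) ∧
      ∫ x, Real.exp (-x) ∂(posLaw μ X (n + 1)) ≤ D * ((n : ℝ) + 1) ^ (-(3 : ℝ) / 2) := by
  have hX := hiid.1
  have hw := measurable_walk hX
  have := Measure.isProbabilityMeasure_map (μ := μ) (hX 1).aemeasurable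
  have (n : ℕ) := Measure.isProbabilityMeasure_map (μ := μ) (hw n).aemeasurable
  obtain ⟨C, hC⟩ := exists_integral_exp_neg_abs_le (ν := μ.map (X 1))
    (by rwa [integral_map (hX 1).aemeasurable (by fun_prop)])
    ((integrable_map_measure (by fun_prop) (hX 1).aemeasurable).2 hsq)
    (by rwa [integral_map (hX 1).aemeasurable (by fun_prop)])
  have hint : ∀ k, Integrable (fun x => Real.exp (-|x|)) (μ.map (walk X k)) := fun k => by
    refine (integrable_const (1 : ℝ)).mono' (by fun_prop) (ae_of_all _ fun x => ?_)
    rw [Real.norm_of_nonneg (Real.exp_pos _).le]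
    exact Real.exp_le_one_iff.2 (neg_nonpos.2 (abs_nonneg x))
  have hbound : ∀ (θ : ℝ) (s : Set ℝ), MeasurableSet s → (∀ x ∈ s, θ * x = -|x|) → ∀ k : ℕ,
      ∫ x in s, Real.exp (θ * x) ∂(μ.map (walk X (k + 1)))
        ≤ C * ((k : ℝ) + 1) ^ (-(1 : ℝ) / 2) := by
    intro θ s hs h k
    rw [setIntegral_congr_fun hs fun x hx => by rw [h x hx]]
    refine (setIntegral_le_integral (hint _) (ae_of_all _ fun x => (Real.exp_pos _).le)).trans ?_
    exact hC _ k fun t => charFun_map_walk hiid (k + 1) t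
  have hv : ∀ n, ∀ᵐ x ∂(minLaw μ X n), x ≤ 0 := by
    rintro (_ | n)
    · rw [minLaw_zero, ae_dirac_iff measurableSet_Iic]
    · filter_upwards [ae_minLaw_neg hX n] with x hx using hx.le
  have hspitzer := spitzer_identity (u := posLaw μ X) (v := minLaw μ X)
    (F := fun n => μ.map (walk X n)) (φ := charFun (μ.map (X 1))) posLaw_zero minLaw_zero
    (ae_posLaw_nonneg hX) (ae_minLaw_neg hX) (charFun_map_walk hiid) (map_walk_eq_sum_conv hiid)
  have hcast : ∀ n : ℕ, (((n : NNReal) + 1 : NNReal) : ℝ) = (n : ℝ) + 1 := fun n => by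
    push_cast
    rfl
  obtain ⟨D₁, hD₁, h₁⟩ := exists_le_rpow_of_recursion
    (B := fun n => ∫ x, Real.exp (1 * x) ∂(minLaw μ X n))
    (b := fun k => ∫ x in Iio 0, Real.exp (1 * x) ∂(μ.map (walk X k)))
    (fun n => integral_nonneg fun x => (Real.exp_pos _).le)
    (hbound 1 (Iio 0) measurableSet_Iio fun x hx => by rw [abs_of_neg hx]; ring)
    (fun n => by
      have := integral_exp_of_smul_eq_sum_conv (θ := 1) (hspitzer n).2
        (fun q => (ae_restrict_mem measurableSet_Iio).mono fun x hx => by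
          rw [one_mul]; exact (mem_Iio.1 hx).le)
        (fun q => (hv q.2).mono fun x hx => by rwa [one_mul])
      rwa [hcast] at this)
  obtain ⟨D₂, hD₂, h₂⟩ := exists_le_rpow_of_recursion
    (B := fun n => ∫ x, Real.exp (-1 * x) ∂(posLaw μ X n))
    (b := fun k => ∫ x in Ici 0, Real.exp (-1 * x) ∂(μ.map (walk X k)))
    (fun n => integral_nonneg fun x => (Real.exp_pos _).le)
    (hbound (-1) (Ici 0) measurableSet_Ici fun x hx => by rw [abs_of_nonneg hx]; ring)
    (fun n => by
      have := integral_exp_of_smul_eq_sum_conv (θ := -1) (hspitzer n).1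
        (fun q => (ae_restrict_mem measurableSet_Ici).mono fun x hx => by
          rw [neg_one_mul, neg_nonpos]; exact hx)
        (fun q => (ae_posLaw_nonneg hX q.2).mono fun x hx => by rwa [neg_one_mul, neg_nonpos])
      rwa [hcast] at this)
  simp only [one_mul, neg_one_mul] at h₁ h₂
  refine ⟨max D₁ D₂, hD₁.trans (le_max_left _ _), fun n => ⟨(h₁ n).trans ?_, (h₂ n).trans ?_⟩⟩
  · gcongr
    exact le_max_left _ _
  · gcongr
    exact le_max_right _ _

end IID

/-- **Duality and the middle estimate.** For a random walk with centered, square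
integrable, non-lattice i.i.d. increments:
(i) for `0 < j < n`, `E[e^{2S_{τ(n)} - S_n}; τ(n) = j]
  = E[e^{S_j}; τ(j) = j] ⬝ E[e^{-S_{n-j}}; L_{n-j} ≥ 0]`;
(ii) for every `ε > 0` there is `N` such that for all sufficiently large `n ≥ 2N+1`,
`∑_{j=N+1}^{n-N-1} E[e^{2S_{τ(n)} - S_n}; τ(n) = j] ≤ ε n^{-3/2}`. -/
theorem statement14
    {Ω : Type*} [MeasurableSpace Ω] (μ : Measure Ω) [IsProbabilityMeasure μ]
    (X : ℕ → Ω → ℝ) (hiid : IIDseq μ X)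
    (hint : Integrable (X 1) μ) (hmean : (∫ ω, X 1 ω ∂μ) = 0)
    (hsq : Integrable (fun ω => X 1 ω ^ 2) μ) (hvar : 0 < ∫ ω, X 1 ω ^ 2 ∂μ)
    (hlat : NonLattice (μ.map (X 1))) :
    (∀ j n : ℕ, 0 < j → j < n →
      ∫ ω in {ω | tauWalk X n ω = j}, Real.exp (2 * walk X j ω - walk X n ω) ∂μ
        = (∫ ω in {ω | tauWalk X j ω = j}, Real.exp (walk X j ω) ∂μ) *
          ∫ ω in posSet X 0 (n - j), Real.exp (-walk X (n - j) ω) ∂μ) ∧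
    ∀ ε : ℝ, 0 < ε → ∃ N n₀ : ℕ, ∀ n : ℕ, n₀ ≤ n → 2 * N + 1 ≤ n →
      ∑ j ∈ Finset.Icc (N + 1) (n - N - 1),
          ∫ ω in {ω | tauWalk X n ω = j}, Real.exp (2 * walk X j ω - walk X n ω) ∂μ
        ≤ ε * (n : ℝ) ^ (-(3 : ℝ) / 2) := by
  have hX := hiid.1
  refine ⟨fun j n _ hjn => setIntegral_tauWalk_eq_mul hiid hjn.le, fun ε hε => ?_⟩
  obtain ⟨D, hD, h⟩ := exists_integral_exp_factors_le hiid hmean hsq hvar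
  obtain ⟨N, hN⟩ := exists_sum_middle_le (D := D * D) (by positivity)
    (a := fun j n => ∫ ω in {ω | tauWalk X n ω = j}, Real.exp (2 * walk X j ω - walk X n ω) ∂μ)
    (fun j n hj hjn => by
      rw [setIntegral_tauWalk_eq_mul hiid hjn.le]
      obtain ⟨k, rfl⟩ := Nat.exists_eq_add_of_lt hjn
      obtain ⟨i, rfl⟩ := Nat.exists_eq_add_of_lt hj
      rw [show 0 + i + 1 + k + 1 - (0 + i + 1) = k + 1 by omega, zero_add, mul_mul_mul_comm,
        ← integral_minLaw hX _ Real.measurable_exp,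
        ← integral_posLaw hX _ (f := fun x => Real.exp (-x)) (by fun_prop)]
      push_cast
      exact mul_le_mul (h i).1 (h k).2 (integral_nonneg fun x => (Real.exp_pos _).le)
        (by positivity)) hε
  exact ⟨N, 0, fun n _ hn => hN n hn⟩

end BPREpaper
end
end
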